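/- Let P be the distribution of a stochastic process ξ = (ξ₁,…,ξ_T) with ξ_t ∈ ℝ^m, viewed as a Borel probability measure on ℝ^ℓ with ℓ = m·T, and suppose Assumption A4 holds: (1) the support of P is D = D₁×…×D_T with each D_t ⊂ ℝ^m compact; (2) P has a Lebesgue density f that is Lipschitz on D with constant L; (3) 0 < c̲ ≤ f(x) ≤ c̄ on D; (4) the kernel k vanishes outside the unit ball of ℝ^ℓ and is Lipschitz with constant L; (5) the conditional probabilities P_t(A|x) := P(ξ_t ∈ A | (ξ₁,…,ξ_{t−1}) = x) satisfy d_W(P_t(·|x), P_t(·|y)) ≤ γ_t‖x−y‖ for all x, y ∈ D and some γ_t > 0. Let P̂_n be the empirical measure of n i.i.d. sample paths from P and let k_h(x) := h^{−ℓ}k(x/h). Then there exists a constant K > 0 such that, for every ε > 0, for appropriately chosen bandwidth h > 0 (depending on ε) and all n sufficiently large, Pⁿ( nd(P, P̂_n * k_h) > ε ) < exp(−K·n·ε^{2ℓ+4}), where * denotes convolution and Pⁿ denotes the law of the n i.i.d. samples. -/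

import Mathlib

open MeasureTheory ProbabilityTheory
open scoped ENNReal NNReal

noncomputable section

/-- The Kantorovich–Wasserstein distance between two Borel probability measures on a
metric measurable space: the infimum of `∫ dist(x,y) dπ` over all couplings `π`. -/
def wdist {α : Type*} [MeasurableSpace α] [PseudoMetricSpace α]
    (μ ν : Measure α) : ℝ :=
  sInf { r | ∃ π : Measure (α × α), IsProbabilityMeasure π ∧
    π.map Prod.fst = μ ∧ π.map Prod.snd = ν ∧ r = ∫ z, dist z.1 z.2 ∂π }

/-- The path space `(ℝ^m)^T`. -/
abbrev PathSp (m T : ℕ) := Fin T → Fin m → ℝ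

/-- Truncation of a path after stage `t` (1-based): coordinates `ξ_1, …, ξ_t` are kept,
later coordinates are set to `0`. -/
def trunc {m T : ℕ} (t : ℕ) (ξ : PathSp m T) : PathSp m T :=
  fun s => if (s : ℕ) < t then ξ s else 0

/-- The canonical filtration on the path space: `𝔉_t` is the σ-algebra generated by the
first `t` coordinate projections. -/
def ftr (m T : ℕ) (t : ℕ) : MeasurableSpace (PathSp m T) :=
  MeasurableSpace.comap (trunc t) inferInstance

/-- The path distance `‖ξ − ξ̃‖ = Σ_t ‖ξ_t − ξ̃_t‖`. -/
def pathDist {m T : ℕ} (ξ ξ' : PathSp m T) : ℝ := ∑ t, dist (ξ t) (ξ' t)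

/-- A nested (bi-causal) coupling of two probability measures on the path space:
a coupling `π` such that, conditionally on `𝔉_t ⊗ 𝔉_t`, the first marginal reproduces
`P(·|𝔉_t)` and the second reproduces `P̃(·|𝔉_t)`, for every stage `t`. -/
def IsNestedCoupling {m T : ℕ} (P P' : Measure (PathSp m T))
    (π : Measure (PathSp m T × PathSp m T)) : Prop :=
  IsProbabilityMeasure π ∧ π.map Prod.fst = P ∧ π.map Prod.snd = P' ∧
  ∀ t, 1 ≤ t → t ≤ T → ∀ A : Set (PathSp m T), MeasurableSet A →
    (π[(A ×ˢ (Set.univ : Set (PathSp m T))).indicator (fun _ => (1 : ℝ)) |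
        (ftr m T t).prod (ftr m T t)]
      =ᵐ[π] fun z => (P[A.indicator (fun _ => (1 : ℝ)) | ftr m T t]) z.1) ∧
    (π[((Set.univ : Set (PathSp m T)) ×ˢ A).indicator (fun _ => (1 : ℝ)) |
        (ftr m T t).prod (ftr m T t)]
      =ᵐ[π] fun z => (P'[A.indicator (fun _ => (1 : ℝ)) | ftr m T t]) z.2)

/-- The nested (process) distance between two probability measures on the path space. -/
def nestedDist {m T : ℕ} (P P' : Measure (PathSp m T)) : ℝ :=
  sInf { r | ∃ π, IsNestedCoupling P P' π ∧ r = ∫ z, pathDist z.1 z.2 ∂π }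

/-- The conditional distribution `P_t(· | x)` of the `t`-th coordinate (0-based) given
that the first `t` coordinates equal `x`. -/
def condK {m T : ℕ} (P : Measure (PathSp m T)) [IsFiniteMeasure P]
    (t : ℕ) (ht : t < T) : Kernel (Fin t → Fin m → ℝ) (Fin m → ℝ) :=
  condDistrib (fun ξ => ξ ⟨t, ht⟩)
    (fun ξ (s : Fin t) => ξ ⟨(s : ℕ), lt_trans s.isLt ht⟩) P


/-- The smoothed empirical measure `P̂_n * k_h`: the measure on the path space with
kernel density estimate `x ↦ n⁻¹ Σ_j k_h(x − ξ^{(j)})`, `k_h(x) = h^{−ℓ} k(x/h)`,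
`ℓ = m·T`. -/
def smoothedEmp {m T : ℕ} {n : ℕ} (k : PathSp m T → ℝ) (h : ℝ)
    (ωs : Fin n → PathSp m T) : Measure (PathSp m T) :=
  volume.withDensity fun x =>
    ENNReal.ofReal ((n : ℝ)⁻¹ * ∑ j, (1 / h ^ (m * T)) * k (h⁻¹ • (x - ωs j)))

/-- **Measurable maximal coupling.** Two Markov kernels can be coupled measurably so that, at equal
parameters, the coupled points differ with probability at most `p x B - q x B`. -/
theorem exists_maximal_coupling_kernel {X E : Type*} [MeasurableSpace X] [MeasurableSpace E]
    [MeasurableSpace.CountablyGenerated E] [MeasurableEq E] [MeasurableEq X]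
    (p q : Kernel X E) [IsMarkovKernel p] [IsMarkovKernel q] :
    ∃ κ : Kernel (X × X) (E × E), IsMarkovKernel κ ∧
      (∀ z, (κ z).map Prod.fst = p z.1) ∧ (∀ z, (κ z).map Prod.snd = q z.2) ∧
      ∃ B : Set (X × E), MeasurableSet B ∧ ∀ x,
        κ (x, x) {e | e.1 ≠ e.2} + q x (Prod.mk x ⁻¹' B) ≤ p x (Prod.mk x ⁻¹' B) := by
  classical
  set r : Kernel X E := p + q with hr
  set a := p.rnDeriv r with ha
  set b := q.rnDeriv r with hb
  have ham : Measurable (Function.uncurry a) := Kernel.measurable_rnDeriv p r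
  have hbm : Measurable (Function.uncurry b) := Kernel.measurable_rnDeriv q r
  have hpr : ∀ x, (r x).withDensity (a x) = p x := fun x => by
    have h : p x ≪ r x := by
      rw [hr, add_apply]; exact Measure.AbsolutelyContinuous.rfl.add_right _
    rw [← Kernel.withDensity_apply _ ham, Kernel.withDensity_rnDeriv_eq h]
  have hqr : ∀ x, (r x).withDensity (b x) = q x := fun x => by
    have h : q x ≪ r x := by
      rw [hr, add_apply, add_comm]; exact Measure.AbsolutelyContinuous.rfl.add_right _
    rw [← Kernel.withDensity_apply _ hbm, Kernel.withDensity_rnDeriv_eq h]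
  have hcm : Measurable (Function.uncurry fun x e => min (a x e) (b x e)) := ham.min hbm
  have hpm : Measurable (Function.uncurry fun x e => a x e - b x e) := ham.sub hbm
  have hqm : Measurable (Function.uncurry fun x e => b x e - a x e) := hbm.sub ham
  set C := r.withDensity fun x e => min (a x e) (b x e) with hC
  set p' := r.withDensity fun x e => a x e - b x e with hp'
  set q' := r.withDensity fun x e => b x e - a x e with hq'
  have hCp : ∀ x, C x + p' x = p x := fun x => by
    rw [← hpr x, hC, hp', Kernel.withDensity_apply _ hcm, Kernel.withDensity_apply _ hpm,
      ← withDensity_add_left hcm.of_uncurry_left]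
    congr 1; ext e
    simp only [Pi.add_apply]
    rcases le_total (a x e) (b x e) with h | h
    · rw [min_eq_left h, tsub_eq_zero_of_le h, add_zero]
    · rw [min_eq_right h, add_tsub_cancel_of_le h]
  have hCq : ∀ x, C x + q' x = q x := fun x => by
    rw [← hqr x, hC, hq', Kernel.withDensity_apply _ hcm, Kernel.withDensity_apply _ hqm,
      ← withDensity_add_left hcm.of_uncurry_left]
    congr 1; ext e
    simp only [Pi.add_apply]
    rcases le_total (a x e) (b x e) with h | h
    · rw [min_eq_left h, add_tsub_cancel_of_le h]
    · rw [min_eq_right h, tsub_eq_zero_of_le h, add_zero]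
  have hCp1 : ∀ x, C x Set.univ + p' x Set.univ = 1 := fun x => by
    rw [← Measure.add_apply, hCp, measure_univ]
  have hCq1 : ∀ x, C x Set.univ + q' x Set.univ = 1 := fun x => by
    rw [← Measure.add_apply, hCq, measure_univ]
  have hCfin : ∀ x, C x Set.univ ≠ ∞ := fun x =>
    ne_top_of_le_ne_top ENNReal.one_ne_top ((hCp1 x) ▸ le_self_add)
  have hpq : ∀ x, q' x Set.univ = p' x Set.univ := fun x =>
    (ENNReal.add_right_inj (hCfin x)).1 ((hCq1 x).trans (hCp1 x).symm)
  have hpfin : ∀ x, p' x Set.univ ≠ ∞ := fun x =>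
    ne_top_of_le_ne_top ENNReal.one_ne_top ((hCp1 x) ▸ le_add_self)
  have hdm : Measurable (Function.uncurry fun (x : X) (_ : E) => (p' x Set.univ)⁻¹) :=
    ((Kernel.measurable_coe p' MeasurableSet.univ).inv).comp measurable_fst
  have : IsFiniteKernel C := ⟨1, ENNReal.one_lt_top, fun x => (hCp1 x) ▸ le_self_add⟩
  have : IsFiniteKernel p' := ⟨1, ENNReal.one_lt_top, fun x => (hCp1 x) ▸ le_add_self⟩
  have : IsFiniteKernel q' := ⟨1, ENNReal.one_lt_top, fun x => (hCq1 x) ▸ le_add_self⟩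
  set p'' := p'.withDensity fun x _ => (p' x Set.univ)⁻¹ with hp''
  have hp''a : ∀ x, p'' x = (p' x Set.univ)⁻¹ • p' x := fun x => by
    rw [hp'', Kernel.withDensity_apply _ hdm, withDensity_const]
  have : IsFiniteKernel p'' := ⟨1, ENNReal.one_lt_top, fun x => by
    rw [hp''a, Measure.smul_apply, smul_eq_mul]; exact ENNReal.inv_mul_le_one _⟩
  have hscale : ∀ x, p' x Set.univ * (p' x Set.univ)⁻¹ * p' x Set.univ = p' x Set.univ := fun x => by
    by_cases h0 : p' x Set.univ = 0
    · simp [h0]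
    · rw [ENNReal.mul_inv_cancel h0 (hpfin x), one_mul]
  have hfull : ∀ x, (p' x Set.univ * (p' x Set.univ)⁻¹) • p' x = p' x ∧
      (p' x Set.univ * (p' x Set.univ)⁻¹) • q' x = q' x := fun x => by
    by_cases h0 : p' x Set.univ = 0
    · have h1 : p' x = 0 := Measure.measure_univ_eq_zero.1 h0
      have h2 : q' x = 0 := Measure.measure_univ_eq_zero.1 ((hpq x).trans h0)
      simp [h1, h2]
    · rw [ENNReal.mul_inv_cancel h0 (hpfin x)]; simp
  set κ₁ : Kernel X (E × E) := C.map (fun e => (e, e)) + p'' ×ₖ q' with hκ₁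
  have hdiag : Measurable fun e : E => (e, e) := measurable_id.prodMk measurable_id
  have hκ₁a : ∀ x, κ₁ x = (C x).map (fun e => (e, e)) + (p'' x).prod (q' x) := fun x => by
    rw [hκ₁, add_apply, Kernel.map_apply _ hdiag, Kernel.prod_apply]
  have h1 : ∀ x, (κ₁ x).map Prod.fst = p x := fun x => by
    rw [hκ₁a, Measure.map_add _ _ measurable_fst, Measure.map_map measurable_fst hdiag,
      Measure.map_fst_prod, hp''a, smul_smul, hpq, (hfull x).1, ← hCp x]
    congr 1
    exact Measure.map_id
  have h2 : ∀ x, (κ₁ x).map Prod.snd = q x := fun x => by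
    rw [hκ₁a, Measure.map_add _ _ measurable_snd, Measure.map_map measurable_snd hdiag,
      Measure.map_snd_prod, hp''a, Measure.smul_apply, smul_eq_mul, mul_comm, (hfull x).2, ← hCq x]
    congr 1
    exact Measure.map_id
  set D : Set (X × X) := {z | z.1 = z.2} with hD
  have hDm : MeasurableSet D := measurableSet_eq_fun measurable_fst measurable_snd
  set κ : Kernel (X × X) (E × E) := Kernel.piecewise hDm (κ₁.comap Prod.fst measurable_fst)
    ((p.comap Prod.fst measurable_fst) ×ₖ (q.comap Prod.snd measurable_snd)) with hκ
  have hf : ∀ z, (κ z).map Prod.fst = p z.1 := fun z => by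
    rw [hκ, Kernel.piecewise_apply]
    split_ifs with h
    · rw [Kernel.comap_apply, h1]
    · rw [Kernel.prod_apply, Measure.map_fst_prod]; simp [Kernel.comap_apply]
  have hs : ∀ z, (κ z).map Prod.snd = q z.2 := fun z => by
    rw [hκ, Kernel.piecewise_apply]
    split_ifs with h
    · rw [Kernel.comap_apply, h2, show z.1 = z.2 from h]
    · rw [Kernel.prod_apply, Measure.map_snd_prod]; simp [Kernel.comap_apply]
  refine ⟨κ, ⟨fun z => ⟨?_⟩⟩, hf, hs, {z | b z.1 z.2 < a z.1 z.2},
    measurableSet_lt hbm ham, fun x => ?_⟩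
  · rw [← measure_univ (μ := p z.1), ← hf z, Measure.map_apply measurable_fst MeasurableSet.univ,
      Set.preimage_univ]
  · have hBm : MeasurableSet {e | b x e < a x e} :=
      measurableSet_lt hbm.of_uncurry_left ham.of_uncurry_left
    have hne : MeasurableSet {e : E × E | e.1 ≠ e.2} :=
      (measurableSet_eq_fun measurable_fst measurable_snd).compl
    have hk : κ (x, x) {e | e.1 ≠ e.2} ≤ p' x Set.univ := by
      rw [hκ, Kernel.piecewise_apply, if_pos (show (x, x) ∈ D from rfl), Kernel.comap_apply, hκ₁a,
        Measure.add_apply, Measure.map_apply hdiag hne]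
      simp only [ne_eq, Set.preimage_ofPred_eq, not_true_eq_false, Set.ofPred_false, measure_empty,
        zero_add]
      refine (measure_mono (Set.subset_univ _)).trans ?_
      rw [← Set.univ_prod_univ, Measure.prod_prod, hp''a, Measure.smul_apply, smul_eq_mul, hpq,
        mul_comm (_⁻¹) _, hscale]
    change κ (x, x) {e | e.1 ≠ e.2} + q x {e | b x e < a x e} ≤ p x {e | b x e < a x e}
    refine (add_le_add_left hk _).trans ?_
    rw [← hpr x, ← hqr x, hp', Kernel.withDensity_apply _ hpm, withDensity_apply _ hBm,
      withDensity_apply _ hBm, withDensity_apply _ MeasurableSet.univ, Measure.restrict_univ,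
      ← lintegral_add_compl (fun e => a x e - b x e) hBm]
    have hz : ∫⁻ e in {e | b x e < a x e}ᶜ, (a x e - b x e) ∂(r x) = 0 := by
      rw [setLIntegral_congr_fun (g := fun _ => 0) hBm.compl
        (fun e he => tsub_eq_zero_of_le (not_lt.1 he))]
      simp
    rw [hz, add_zero, ← lintegral_add_left hpm.of_uncurry_left]
    exact le_of_eq (setLIntegral_congr_fun hBm fun e he => tsub_add_cancel_of_le (le_of_lt he))

theorem map_compProd_eq_withDensity {Ω X F E : Type*} [MeasurableSpace Ω] [MeasurableSpace X]
    [MeasurableSpace F] [MeasurableSpace E] {π : Measure Ω} [SFinite π] {κ : Kernel Ω F}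
    [IsSFiniteKernel κ] {p : Kernel X E} [IsSFiniteKernel p] {g : Ω → X} (hg : Measurable g)
    {u : F → E} (hu : Measurable u) (hκ : ∀ ω, (κ ω).map u = p (g ω))
    {μ : Measure X} [SFinite μ] {ρ : X → ℝ≥0∞} (hρ : Measurable ρ)
    (hmap : π.map g = μ.withDensity ρ) :
    (π ⊗ₘ κ).map (fun z => (g z.1, u z.2)) = (μ ⊗ₘ p).withDensity (fun z => ρ z.1) := by
  have hgu : Measurable fun z : Ω × F => (g z.1, u z.2) := by fun_prop
  ext A hA
  have hpA : Measurable fun x => p x (Prod.mk x ⁻¹' A) := Kernel.measurable_kernel_prodMk_left hA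
  rw [Measure.map_apply hgu hA, Measure.compProd_apply (hgu hA), withDensity_apply _ hA,
    ← lintegral_indicator hA, Measure.lintegral_compProd
      ((show Measurable fun z : X × E => ρ z.1 from hρ.comp measurable_fst).indicator hA)]
  calc ∫⁻ ω, κ ω (Prod.mk ω ⁻¹' ((fun z => (g z.1, u z.2)) ⁻¹' A)) ∂π
      = ∫⁻ ω, p (g ω) (Prod.mk (g ω) ⁻¹' A) ∂π := by
        refine lintegral_congr fun ω => ?_
        rw [← hκ ω, Measure.map_apply hu (measurable_prodMk_left hA)]
        rfl
    _ = ∫⁻ x, p x (Prod.mk x ⁻¹' A) ∂(π.map g) := (lintegral_map hpA hg).symm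
    _ = ∫⁻ x, ρ x * p x (Prod.mk x ⁻¹' A) ∂μ := by
        rw [hmap, lintegral_withDensity_eq_lintegral_mul _ hρ hpA]; rfl
    _ = _ := by
        refine lintegral_congr fun x => ?_
        have : (fun b => A.indicator (fun z : X × E => ρ z.1) (x, b)) =
            (Prod.mk x ⁻¹' A).indicator fun _ => ρ x := by
          ext b; by_cases h : (x, b) ∈ A <;> simp [Set.indicator, h]
        rw [this, lintegral_indicator_const (measurable_prodMk_left hA)]

theorem measurable_trunc {m T : ℕ} (t : ℕ) : Measurable (trunc t : PathSp m T → PathSp m T) := by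
  refine measurable_pi_lambda _ fun s => ?_
  unfold trunc
  by_cases h : (s : ℕ) < t
  · simpa [h] using measurable_pi_apply s
  · simp [h]

theorem ftr_le {m T : ℕ} (t : ℕ) :
    ftr m T t ≤ MeasurableSpace.pi :=
  (measurable_trunc t).comap_le

theorem trunc_trunc {m T : ℕ} (t : ℕ) (x : PathSp m T) : trunc t (trunc t x) = trunc t x := by
  ext s; simp only [trunc]; split_ifs <;> rfl

theorem trunc_update {m T : ℕ} {t : ℕ} {s : Fin T} (h : t ≤ s) (x : PathSp m T)
    (e : Fin m → ℝ) : trunc t (Function.update x s e) = trunc t x := by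
  ext r
  simp only [trunc]
  split_ifs with hr
  · rw [Function.update_of_ne (by rintro rfl; omega)]
  · rfl

theorem trunc_succ {m T : ℕ} {t : ℕ} (ht : t < T) (x : PathSp m T) :
    trunc (t + 1) x = Function.update (trunc t x) ⟨t, ht⟩ (x ⟨t, ht⟩) := by
  ext r
  by_cases hr : r = ⟨t, ht⟩
  · subst hr; simp [trunc]
  · have : (r : ℕ) ≠ t := fun h => hr (Fin.ext h)
    rw [Function.update_of_ne hr]
    have h' : (r : ℕ) < t + 1 ↔ (r : ℕ) < t := by omega
    simp only [trunc, h']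

theorem trunc_self {m T : ℕ} (x : PathSp m T) : trunc T x = x := by
  ext r; simp [trunc]

theorem trunc_zero {m T : ℕ} (x : PathSp m T) : trunc 0 x = 0 := by
  ext r; simp [trunc]

/-- `X` is causal with respect to `Y` at stage `s`: the law of `X` restricted to an event
`Y ∈ S` with `S ∈ 𝔉_s` has an `𝔉_s`-measurable density with respect to the law `P` of `X`. -/
def IsCausal {m T : ℕ} {Ω : Type*} [MeasurableSpace Ω] (s : ℕ) (P : Measure (PathSp m T))
    (π : Measure Ω) (X Y : Ω → PathSp m T) : Prop :=
  ∀ S, MeasurableSet[ftr m T s] S → ∃ ρ : PathSp m T → ℝ≥0∞, Measurable[ftr m T s] ρ ∧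
    (π.restrict (Y ⁻¹' S)).map X = P.withDensity ρ

theorem IsCausal.of_map_trunc_eq {m T : ℕ} {Ω : Type*} [MeasurableSpace Ω] {s : ℕ}
    {P : Measure (PathSp m T)} {π : Measure Ω} [IsFiniteMeasure π] {X Y : Ω → PathSp m T}
    (hX : Measurable X) (hP : π.map X = P) (htr : P.map (trunc s) = P) : IsCausal s P π X Y := by
  intro S _
  have hle : (π.restrict (Y ⁻¹' S)).map X ≤ P := by
    rw [← hP]; exact Measure.map_mono Measure.restrict_le_self hX
  have : IsFiniteMeasure P := by rw [← hP]; infer_instance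
  have hac : (π.restrict (Y ⁻¹' S)).map X ≪ P := Measure.absolutelyContinuous_of_le hle
  refine ⟨((π.restrict (Y ⁻¹' S)).map X).rnDeriv P ∘ trunc s,
    (Measure.measurable_rnDeriv _ _).comp (comap_measurable _), ?_⟩
  have hfix : ∀ᵐ x ∂P, trunc s x = x := by
    rw [← htr, ae_map_iff (p := fun x => trunc s x = x) (measurable_trunc s).aemeasurable
      (measurableSet_eq_fun (measurable_trunc s) measurable_id)]
    exact Filter.Eventually.of_forall fun x => trunc_trunc s x
  conv_lhs => rw [← Measure.withDensity_rnDeriv_eq _ _ hac]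
  refine withDensity_congr_ae ?_
  filter_upwards [hfix] with x hx
  simp [hx]

theorem IsCausal.map {m T : ℕ} {Ω Ω' : Type*} [MeasurableSpace Ω] [MeasurableSpace Ω'] {s : ℕ}
    {P : Measure (PathSp m T)} {π : Measure Ω} {X Y : Ω' → PathSp m T} {φ : Ω → Ω'}
    (hφ : Measurable φ) (hX : Measurable X) (hY : Measurable Y)
    (h : IsCausal s P π (X ∘ φ) (Y ∘ φ)) : IsCausal s P (π.map φ) X Y := by
  intro S hS
  obtain ⟨ρ, hρ, he⟩ := h S hS
  refine ⟨ρ, hρ, ?_⟩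
  rw [← he, Measure.restrict_map hφ (hY (ftr_le s _ hS)), Measure.map_map hX hφ]
  rfl

theorem update_measurable {m T : ℕ} (s : Fin T) :
    Measurable fun z : PathSp m T × (Fin m → ℝ) => Function.update z.1 s z.2 := by
  refine measurable_pi_lambda _ fun r => ?_
  by_cases hr : r = s
  · subst hr; simpa using measurable_snd
  · simp only [Function.update_of_ne hr]; exact (measurable_pi_apply r).comp measurable_fst

theorem map_update_compProd {m T : ℕ} {Ω F : Type*} [MeasurableSpace Ω]
    [MeasurableSpace F] {π : Measure Ω} [SFinite π] {κ : Kernel Ω F} [IsSFiniteKernel κ]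
    {s : Fin T} {p : Kernel (PathSp m T) (Fin m → ℝ)} [IsSFiniteKernel p]
    {X : Ω → PathSp m T} (hX : Measurable X) {u : F → Fin m → ℝ} (hu : Measurable u)
    (hκ : ∀ ω, (κ ω).map u = p (X ω)) {μ μ' : Measure (PathSp m T)} [SFinite μ]
    (hμ : (μ ⊗ₘ p).map (fun z => Function.update z.1 s z.2) = μ')
    {ρ : PathSp m T → ℝ≥0∞} (hρ : Measurable ρ) (hρs : ∀ x e, ρ (Function.update x s e) = ρ x)
    (hmap : π.map X = μ.withDensity ρ) :
    (π ⊗ₘ κ).map (fun z => Function.update (X z.1) s (u z.2)) = μ'.withDensity ρ := by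
  have hgu : Measurable fun z : Ω × F => (X z.1, u z.2) := by fun_prop
  have h := map_compProd_eq_withDensity hX hu hκ hρ hmap
  have h2 : (fun z : Ω × F => Function.update (X z.1) s (u z.2)) =
    (fun z : PathSp m T × (Fin m → ℝ) => Function.update z.1 s z.2) ∘ fun z => (X z.1, u z.2) := rfl
  rw [h2, ← Measure.map_map (update_measurable s) hgu, h, ← hμ]
  ext A hA
  rw [Measure.map_apply (update_measurable s) hA, withDensity_apply _ (update_measurable s hA),
    withDensity_apply _ hA, setLIntegral_map hA hρ (update_measurable s)]
  simp only [hρs]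

theorem IsCausal.compProd {m T : ℕ} {Ω F : Type*} [MeasurableSpace Ω]
    [MeasurableSpace F] {π : Measure Ω} [IsFiniteMeasure π] {κ : Kernel Ω F} [IsSFiniteKernel κ]
    {r : ℕ} {s : Fin T} (hrs : r ≤ s) {p : Kernel (PathSp m T) (Fin m → ℝ)} [IsSFiniteKernel p]
    {X Y : Ω → PathSp m T} (hX : Measurable X) (hY : Measurable Y)
    {u : F → Fin m → ℝ} (hu : Measurable u) (v : F → Fin m → ℝ)
    (hκ : ∀ ω, (κ ω).map u = p (X ω)) {μ μ' : Measure (PathSp m T)} [SFinite μ]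
    (hμ : (μ ⊗ₘ p).map (fun z => Function.update z.1 s z.2) = μ') (h : IsCausal r μ π X Y) :
    IsCausal r μ' (π ⊗ₘ κ) (fun z => Function.update (X z.1) s (u z.2))
      (fun z => Function.update (Y z.1) s (v z.2)) := by
  intro S hS
  obtain ⟨ρ, hρ, he⟩ := h S hS
  refine ⟨ρ, hρ, ?_⟩
  have hSm : MeasurableSet (Y ⁻¹' S) := hY (ftr_le r _ hS)
  have hpre : (fun z : Ω × F => Function.update (Y z.1) s (v z.2)) ⁻¹' S = (Y ⁻¹' S) ×ˢ Set.univ := by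
    obtain ⟨S', -, rfl⟩ := hS
    ext z
    simp [trunc_update hrs]
  have hres : (π ⊗ₘ κ).restrict ((Y ⁻¹' S) ×ˢ Set.univ) = (π.restrict (Y ⁻¹' S)) ⊗ₘ κ := by
    ext A hA
    rw [Measure.restrict_apply hA, Measure.compProd_apply (hA.inter (hSm.prod MeasurableSet.univ)),
      Measure.compProd_apply hA, ← lintegral_indicator hSm]
    refine lintegral_congr fun ω => ?_
    by_cases hω : ω ∈ Y ⁻¹' S
    · rw [Set.indicator_of_mem hω]; congr 1; ext f; simpa using fun _ => hω
    · rw [Set.indicator_of_notMem hω, ← measure_empty (μ := κ ω)]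
      congr 1; ext f
      simp only [Set.mem_preimage] at hω
      simp [hω]
  rw [hpre, hres]
  exact map_update_compProd hX hu hκ hμ (hρ.mono (ftr_le r) le_rfl)
    (fun x e => hρ.factorsThrough (trunc_update hrs x e)) he

theorem setIntegral_condExp_withDensity {α : Type*} {m m₀ : MeasurableSpace α}
    (hm : m ≤ m₀) {μ : Measure α} [IsFiniteMeasure μ] {ρ : α → ℝ≥0∞}
    (hρ : Measurable[m] ρ) (hρi : ∫⁻ x, ρ x ∂μ ≠ ∞) {f : α → ℝ} (hf : Integrable f μ)
    {c : ℝ} (hfb : ∀ x, ‖f x‖ ≤ c) {S : Set α} (hS : MeasurableSet[m] S) :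
    ∫ x in S, (μ[f | m]) x ∂(μ.withDensity ρ) = ∫ x in S, f x ∂(μ.withDensity ρ) := by
  have hρ' : Measurable ρ := hρ.mono hm le_rfl
  have hfin : ∀ᵐ x ∂(μ.restrict S), ρ x < ∞ := ae_restrict_of_ae (ae_lt_top hρ' hρi)
  have hρint : Integrable (fun x => (ρ x).toReal) μ :=
    integrable_toReal_of_lintegral_ne_top hρ'.aemeasurable hρi
  have hprod : Integrable (fun x => (ρ x).toReal * f x) μ :=
    hρint.mul_bdd (c := c) hf.aestronglyMeasurable (Filter.Eventually.of_forall hfb)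
  rw [setIntegral_withDensity_eq_setIntegral_toReal_smul hρ' hfin _ (hm S hS),
    setIntegral_withDensity_eq_setIntegral_toReal_smul hρ' hfin _ (hm S hS)]
  simp only [smul_eq_mul]
  rw [← setIntegral_condExp hm hprod hS]
  refine setIntegral_congr_ae (hm S hS) ?_
  filter_upwards [condExp_mul_of_stronglyMeasurable_left (m := m)
    (f := fun x => (ρ x).toReal) (g := f) (hρ.ennreal_toReal.stronglyMeasurable) hprod hf] with x hx _
  exact hx.symm

theorem IsCausal.condExp_eq {m T : ℕ} {Ω : Type*} [MeasurableSpace Ω] {t : ℕ}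
    {P : Measure (PathSp m T)} [IsFiniteMeasure P] {π : Measure Ω} [IsFiniteMeasure π]
    {X Y : Ω → PathSp m T} (hX : Measurable X) (hY : Measurable Y) (hP : π.map X = P)
    (h : IsCausal t P π X Y) {A : Set (PathSp m T)} (hA : MeasurableSet A) :
    π[fun ω => A.indicator (fun _ => (1 : ℝ)) (X ω) |
        (ftr m T t).comap X ⊔ (ftr m T t).comap Y]
      =ᵐ[π] fun ω => (P[A.indicator (fun _ => (1 : ℝ)) | ftr m T t]) (X ω) := by
  set f : PathSp m T → ℝ := A.indicator (fun _ => (1 : ℝ)) with hf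
  set g : PathSp m T → ℝ := P[f | ftr m T t] with hg
  have hXle : (ftr m T t).comap X ≤ ‹MeasurableSpace Ω› :=
    (MeasurableSpace.comap_mono (ftr_le t)).trans hX.comap_le
  have hYle : (ftr m T t).comap Y ≤ ‹MeasurableSpace Ω› :=
    (MeasurableSpace.comap_mono (ftr_le t)).trans hY.comap_le
  have hle := sup_le hXle hYle
  have hfi : Integrable f P := (integrable_const (1 : ℝ)).indicator hA
  have hgi : Integrable g P := integrable_condExp
  have hfX : Integrable (fun ω => f (X ω)) π := (hP ▸ hfi).comp_measurable hX
  have hgX : Integrable (fun ω => g (X ω)) π := (hP ▸ hgi).comp_measurable hX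
  have hfb : ∀ x, ‖f x‖ ≤ 1 := fun x => by
    rw [hf]; exact norm_indicator_le_norm_self (fun _ => (1 : ℝ)) x |>.trans (by simp)
  have key : ∀ S' : Set (PathSp m T × PathSp m T),
      MeasurableSet[(ftr m T t).prod (ftr m T t)] S' →
      ∫ ω in (fun ω => (X ω, Y ω)) ⁻¹' S', g (X ω) ∂π =
        ∫ ω in (fun ω => (X ω, Y ω)) ⁻¹' S', f (X ω) ∂π := by
    have hmeas : ∀ S' : Set (PathSp m T × PathSp m T),
        MeasurableSet[(ftr m T t).prod (ftr m T t)] S' →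
        MeasurableSet ((fun ω => (X ω, Y ω)) ⁻¹' S') := fun S' hS' =>
      (hX.prodMk hY) ((sup_le_sup (MeasurableSpace.comap_mono (ftr_le t))
        (MeasurableSpace.comap_mono (ftr_le t))) S' hS')
    have hgen := (@generateFrom_prod _ _ (ftr m T t) (ftr m T t)).symm
    have hpi := (@isPiSystem_prod _ _ (ftr m T t) (ftr m T t))
    intro S' hS'
    have hrect : ∀ S₁ S₂, MeasurableSet[ftr m T t] S₁ → MeasurableSet[ftr m T t] S₂ →
        ∫ ω in (fun ω => (X ω, Y ω)) ⁻¹' (S₁ ×ˢ S₂), g (X ω) ∂π =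
          ∫ ω in (fun ω => (X ω, Y ω)) ⁻¹' (S₁ ×ˢ S₂), f (X ω) ∂π := by
      intro S₁ S₂ h₁ h₂
      have hm₁ := ftr_le t _ h₁
      have hm₂ := ftr_le t _ h₂
      obtain ⟨ρ, hρ, he⟩ := h S₂ h₂
      have hpre : (fun ω => (X ω, Y ω)) ⁻¹' (S₁ ×ˢ S₂) = X ⁻¹' S₁ ∩ Y ⁻¹' S₂ := by
        ext; simp
      have hle' : (π.restrict (Y ⁻¹' S₂)).map X ≤ P := by
        rw [← hP]; exact Measure.map_mono Measure.restrict_le_self hX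
      have hρi : ∫⁻ x, ρ x ∂P ≠ ∞ := by
        have : (P.withDensity ρ) Set.univ ≠ ∞ := by
          rw [← he]; exact measure_ne_top _ _
        rwa [withDensity_apply _ MeasurableSet.univ, Measure.restrict_univ] at this
      have tr : ∀ φ : PathSp m T → ℝ, AEStronglyMeasurable φ P →
          ∫ ω in X ⁻¹' S₁ ∩ Y ⁻¹' S₂, φ (X ω) ∂π = ∫ x in S₁, φ x ∂(P.withDensity ρ) := by
        intro φ hφ
        rw [← he, setIntegral_map hm₁ (hφ.mono_measure hle') hX.aemeasurable,
          Measure.restrict_restrict (hX hm₁)]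
      rw [hpre, tr g hgi.aestronglyMeasurable, tr f hfi.aestronglyMeasurable]
      exact setIntegral_condExp_withDensity (ftr_le t) hρ hρi hfi hfb h₁
    have htot : ∫ ω, g (X ω) ∂π = ∫ ω, f (X ω) ∂π := by
      have := hrect Set.univ Set.univ (@MeasurableSet.univ _ (ftr m T t))
        (@MeasurableSet.univ _ (ftr m T t))
      simpa using this
    induction S', hS' using MeasurableSpace.induction_on_inter hgen hpi with
    | empty => simp
    | basic S' hS' =>
      obtain ⟨S₁, h₁, S₂, h₂, rfl⟩ := hS'
      exact hrect S₁ S₂ h₁ h₂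
    | compl S' hS' ih =>
      rw [Set.preimage_compl, setIntegral_compl (hmeas _ hS') hgX,
        setIntegral_compl (hmeas _ hS') hfX, ih, htot]
    | iUnion F hd hF ih =>
      have hd' : Pairwise (Function.onFun Disjoint
          fun i => (fun ω => (X ω, Y ω)) ⁻¹' F i) :=
        fun i j hij => (hd hij).preimage _
      rw [Set.preimage_iUnion, integral_iUnion (fun i => hmeas _ (hF i)) hd' hgX.integrableOn,
        integral_iUnion (fun i => hmeas _ (hF i)) hd' hfX.integrableOn]
      exact tsum_congr ih
  refine (ae_eq_condExp_of_forall_setIntegral_eq hle hfX (fun s _ _ => hgX.integrableOn)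
    (fun S hS _ => ?_) ?_).symm
  · have hcomap : (ftr m T t).comap X ⊔ (ftr m T t).comap Y =
        ((ftr m T t).prod (ftr m T t)).comap (fun ω => (X ω, Y ω)) := by
      rw [MeasurableSpace.prod, MeasurableSpace.comap_sup, MeasurableSpace.comap_comp,
        MeasurableSpace.comap_comp]
      rfl
    rw [hcomap] at hS
    obtain ⟨S', hS', rfl⟩ := hS
    exact key S' hS'
  · have hXm : Measurable[(ftr m T t).comap X ⊔ (ftr m T t).comap Y, ftr m T t] X :=
      Measurable.of_comap_le le_sup_left
    exact (stronglyMeasurable_condExp.comp_measurable hXm).aestronglyMeasurable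

theorem isNestedCoupling_of_isCausal {m T : ℕ} {P Q : Measure (PathSp m T)} [IsFiniteMeasure P]
    [IsFiniteMeasure Q] {π : Measure (PathSp m T × PathSp m T)} [IsProbabilityMeasure π]
    (hP : π.map Prod.fst = P) (hQ : π.map Prod.snd = Q)
    (hPc : ∀ t ≤ T, IsCausal t P π Prod.fst Prod.snd)
    (hQc : ∀ t ≤ T, IsCausal t Q π Prod.snd Prod.fst) : IsNestedCoupling P Q π := by
  refine ⟨inferInstance, hP, hQ, fun t _ ht A hA => ⟨?_, ?_⟩⟩
  · have h := (hPc t ht).condExp_eq measurable_fst measurable_snd hP hA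
    have e : (A ×ˢ (Set.univ : Set (PathSp m T))).indicator (fun _ => (1 : ℝ)) =
        fun z => A.indicator (fun _ => (1 : ℝ)) z.1 := by
      funext z; by_cases h : z.1 ∈ A <;> simp [Set.indicator, h]
    rw [e]
    exact h
  · have h := (hQc t ht).condExp_eq measurable_snd measurable_fst hQ hA
    rw [sup_comm] at h
    have e : ((Set.univ : Set (PathSp m T)) ×ˢ A).indicator (fun _ => (1 : ℝ)) =
        fun z => A.indicator (fun _ => (1 : ℝ)) z.2 := by
      funext z; by_cases h : z.2 ∈ A <;> simp [Set.indicator, h]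
    rw [e]
    exact h

theorem compProd_measure_ne_le {X E : Type*} [MeasurableSpace X] [MeasurableSpace E]
    [MeasurableEq X] {π : Measure (X × X)} [IsProbabilityMeasure π] {p q : Kernel X E}
    [IsMarkovKernel p] [IsMarkovKernel q] {κ : Kernel (X × X) (E × E)} [IsMarkovKernel κ]
    {B : Set (X × E)} (hB : MeasurableSet B)
    (hκ : ∀ x, κ (x, x) {e | e.1 ≠ e.2} + q x (Prod.mk x ⁻¹' B) ≤ p x (Prod.mk x ⁻¹' B))
    {τ : ℝ≥0∞} (hτ : (π.map Prod.fst ⊗ₘ p) B ≤ (π.map Prod.snd ⊗ₘ q) B + τ)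
    (hE : MeasurableSet {e : E × E | e.1 ≠ e.2}) :
    (π ⊗ₘ κ) {w | w.1.1 ≠ w.1.2 ∨ w.2.1 ≠ w.2.2} ≤ 2 * π {z | z.1 ≠ z.2} + τ := by
  have hD : MeasurableSet {z : X × X | z.1 = z.2} :=
    measurableSet_eq_fun measurable_fst measurable_snd
  set D : Set (X × X) := {z | z.1 = z.2} with hDdef
  have hDc : {z : X × X | z.1 ≠ z.2} = Dᶜ := rfl
  have hpm : Measurable fun x => p x (Prod.mk x ⁻¹' B) := Kernel.measurable_kernel_prodMk_left hB
  have hqm : Measurable fun x => q x (Prod.mk x ⁻¹' B) := Kernel.measurable_kernel_prodMk_left hB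
  have hqm1 : Measurable fun z : X × X => q z.1 (Prod.mk z.1 ⁻¹' B) := hqm.comp measurable_fst
  have hqm2 : Measurable fun z : X × X => q z.2 (Prod.mk z.2 ⁻¹' B) := hqm.comp measurable_snd
  set I : ℝ≥0∞ := ∫⁻ z in D, κ z {e | e.1 ≠ e.2} ∂π with hI
  set J : ℝ≥0∞ := ∫⁻ z in D, q z.1 (Prod.mk z.1 ⁻¹' B) ∂π with hJ
  have hJfin : J ≠ ∞ := by
    refine ne_top_of_le_ne_top ENNReal.one_ne_top ?_
    calc J ≤ ∫⁻ z in D, 1 ∂π := lintegral_mono fun z => prob_le_one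
      _ ≤ 1 := by simpa using prob_le_one
  have h1 : I + J ≤ (π.map Prod.fst ⊗ₘ p) B := by
    rw [Measure.compProd_apply hB, lintegral_map hpm measurable_fst, hI, hJ,
      ← lintegral_add_right _ hqm1]
    refine (setLIntegral_mono (hpm.comp measurable_fst) fun z hz => ?_).trans
      (setLIntegral_le_lintegral D _)
    obtain ⟨x, y⟩ := z
    obtain rfl : x = y := hz
    exact hκ x
  have h2 : (π.map Prod.snd ⊗ₘ q) B ≤ J + π Dᶜ := by
    rw [Measure.compProd_apply hB, lintegral_map hqm measurable_snd, ← lintegral_add_compl _ hD]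
    refine add_le_add (le_of_eq (setLIntegral_congr_fun hD fun z hz => ?_)) ?_
    · obtain ⟨x, y⟩ := z
      obtain rfl : x = y := hz
      rfl
    · calc ∫⁻ z in Dᶜ, q z.2 (Prod.mk z.2 ⁻¹' B) ∂π ≤ ∫⁻ z in Dᶜ, 1 ∂π :=
          lintegral_mono fun z => prob_le_one
        _ = π Dᶜ := by simp
  have h3 : I ≤ π Dᶜ + τ := by
    refine (ENNReal.add_le_add_iff_right hJfin).1 ?_
    calc I + J ≤ J + π Dᶜ + τ := h1.trans (hτ.trans (by gcongr))
      _ = π Dᶜ + τ + J := by ring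
  have hW : MeasurableSet {w : (X × X) × (E × E) | w.1.1 ≠ w.1.2 ∨ w.2.1 ≠ w.2.2} :=
    (hD.compl.preimage measurable_fst).union (hE.preimage measurable_snd)
  rw [Measure.compProd_apply hW, ← lintegral_add_compl _ hD]
  have h4 : ∫⁻ z in D, κ z (Prod.mk z ⁻¹' {w | w.1.1 ≠ w.1.2 ∨ w.2.1 ≠ w.2.2}) ∂π = I := by
    refine setLIntegral_congr_fun hD fun z hz => ?_
    have hz' : z.1 = z.2 := hz
    simp [hz']
  have h5 : ∫⁻ z in Dᶜ, κ z (Prod.mk z ⁻¹' {w | w.1.1 ≠ w.1.2 ∨ w.2.1 ≠ w.2.2}) ∂π ≤ π Dᶜ := by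
    calc _ ≤ ∫⁻ z in Dᶜ, 1 ∂π := lintegral_mono fun z => prob_le_one
      _ = π Dᶜ := by simp
  rw [h4, hDc]
  calc I + _ ≤ (π Dᶜ + τ) + π Dᶜ := add_le_add h3 h5
    _ = 2 * π Dᶜ + τ := by ring

theorem exists_kernel_trunc_succ {m T : ℕ} (P : Measure (PathSp m T)) [IsProbabilityMeasure P]
    {t : ℕ} (ht : t < T) :
    ∃ p : Kernel (PathSp m T) (Fin m → ℝ), IsMarkovKernel p ∧
      P.map (trunc t) ⊗ₘ p = P.map (fun x => (trunc t x, x ⟨t, ht⟩)) ∧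
      (P.map (trunc t) ⊗ₘ p).map (fun z => Function.update z.1 ⟨t, ht⟩ z.2) =
        P.map (trunc (t + 1)) := by
  have hm : Measurable fun x : PathSp m T => (trunc t x, x ⟨t, ht⟩) :=
    (measurable_trunc t).prodMk (measurable_pi_apply _)
  have h : P.map (trunc t) ⊗ₘ condDistrib (fun x => x ⟨t, ht⟩) (trunc t) P =
      P.map (fun x => (trunc t x, x ⟨t, ht⟩)) :=
    compProd_map_condDistrib (measurable_pi_apply _).aemeasurable
  refine ⟨condDistrib (fun x => x ⟨t, ht⟩) (trunc t) P, inferInstance, h, ?_⟩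
  rw [h, Measure.map_map (update_measurable _) hm]
  congr 1
  funext x
  exact (trunc_succ ht x).symm

theorem exists_trunc_coupling {m T : ℕ} (P Q : Measure (PathSp m T)) [IsProbabilityMeasure P]
    [IsProbabilityMeasure Q] {τ : ℝ≥0∞} (hτ : ∀ A, MeasurableSet A → P A ≤ Q A + τ) :
    ∀ t ≤ T, ∃ π : Measure (PathSp m T × PathSp m T), IsProbabilityMeasure π ∧
      π.map Prod.fst = P.map (trunc t) ∧ π.map Prod.snd = Q.map (trunc t) ∧
      (∀ s ≤ t, IsCausal s (P.map (trunc t)) π Prod.fst Prod.snd) ∧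
      (∀ s ≤ t, IsCausal s (Q.map (trunc t)) π Prod.snd Prod.fst) ∧
      π {z | z.1 ≠ z.2} + τ ≤ 2 ^ t * τ := by
  have hself : ∀ (R : Measure (PathSp m T)) (t : ℕ),
      (R.map (trunc t)).map (trunc t) = R.map (trunc t) := fun R t => by
    rw [Measure.map_map (measurable_trunc t) (measurable_trunc t)]
    congr 1; funext x; exact trunc_trunc t x
  intro t
  induction t with
  | zero =>
    intro _
    have h0 : ∀ R : Measure (PathSp m T), IsProbabilityMeasure R →
        R.map (trunc 0) = Measure.dirac 0 := fun R _ => by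
      rw [show (trunc 0 : PathSp m T → PathSp m T) = fun _ => 0 from funext trunc_zero,
        Measure.map_const, measure_univ, one_smul]
    have hf : (Measure.dirac ((0 : PathSp m T), (0 : PathSp m T))).map Prod.fst =
        P.map (trunc 0) := by rw [h0 P ‹_›, Measure.map_dirac' measurable_fst]
    have hs : (Measure.dirac ((0 : PathSp m T), (0 : PathSp m T))).map Prod.snd =
        Q.map (trunc 0) := by rw [h0 Q ‹_›, Measure.map_dirac' measurable_snd]
    refine ⟨Measure.dirac (0, 0), inferInstance, hf, hs, fun s hs0 => ?_, fun s hs0 => ?_, ?_⟩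
    · obtain rfl : s = 0 := by omega
      exact .of_map_trunc_eq measurable_fst hf (hself _ _)
    · obtain rfl : s = 0 := by omega
      exact .of_map_trunc_eq measurable_snd hs (hself _ _)
    · have : MeasurableSet {z : PathSp m T × PathSp m T | z.1 ≠ z.2} :=
        (measurableSet_eq_fun measurable_fst measurable_snd).compl
      rw [Measure.dirac_apply' _ this]
      simp
  | succ t ih =>
    intro ht
    obtain ⟨π, hπ, hf, hs, hcf, hcs, hne⟩ := ih (by omega)
    obtain ⟨p, hp, hpd, hpu⟩ := exists_kernel_trunc_succ P ht
    obtain ⟨q, hq, hqd, hqu⟩ := exists_kernel_trunc_succ Q ht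
    obtain ⟨κ, hκ, hκf, hκs, B, hB, hκB⟩ := exists_maximal_coupling_kernel p q
    have : IsProbabilityMeasure (P.map (trunc t)) :=
      Measure.isProbabilityMeasure_map (measurable_trunc t).aemeasurable
    have : IsProbabilityMeasure (Q.map (trunc t)) :=
      Measure.isProbabilityMeasure_map (measurable_trunc t).aemeasurable
    set X' : (PathSp m T × PathSp m T) × ((Fin m → ℝ) × (Fin m → ℝ)) → PathSp m T :=
      fun w => Function.update w.1.1 ⟨t, ht⟩ w.2.1 with hX'
    set Y' : (PathSp m T × PathSp m T) × ((Fin m → ℝ) × (Fin m → ℝ)) → PathSp m T :=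
      fun w => Function.update w.1.2 ⟨t, ht⟩ w.2.2 with hY'
    have hX'm : Measurable X' := (update_measurable ⟨t, ht⟩).comp
      ((measurable_fst.comp measurable_fst).prodMk (measurable_fst.comp measurable_snd))
    have hY'm : Measurable Y' := (update_measurable ⟨t, ht⟩).comp
      ((measurable_snd.comp measurable_fst).prodMk (measurable_snd.comp measurable_snd))
    have hφ : Measurable fun w => (X' w, Y' w) := hX'm.prodMk hY'm
    have hX'map : (π ⊗ₘ κ).map X' = P.map (trunc (t + 1)) := by
      have := map_update_compProd measurable_fst measurable_fst hκf hpu (ρ := 1)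
        measurable_one (fun _ _ => rfl) (by rw [hf, withDensity_one])
      rwa [withDensity_one] at this
    have hY'map : (π ⊗ₘ κ).map Y' = Q.map (trunc (t + 1)) := by
      have := map_update_compProd measurable_snd measurable_snd hκs hqu (ρ := 1)
        measurable_one (fun _ _ => rfl) (by rw [hs, withDensity_one])
      rwa [withDensity_one] at this
    have hf' : ((π ⊗ₘ κ).map fun w => (X' w, Y' w)).map Prod.fst = P.map (trunc (t + 1)) := by
      rw [Measure.map_map measurable_fst hφ]; exact hX'map
    have hs' : ((π ⊗ₘ κ).map fun w => (X' w, Y' w)).map Prod.snd = Q.map (trunc (t + 1)) := by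
      rw [Measure.map_map measurable_snd hφ]; exact hY'map
    have hprob : IsProbabilityMeasure ((π ⊗ₘ κ).map fun w => (X' w, Y' w)) :=
      Measure.isProbabilityMeasure_map hφ.aemeasurable
    refine ⟨(π ⊗ₘ κ).map fun w => (X' w, Y' w), hprob, hf', hs', fun s hst => ?_,
      fun s hst => ?_, ?_⟩
    · rcases hst.eq_or_lt with rfl | hlt
      · exact .of_map_trunc_eq measurable_fst hf' (hself _ _)
      · exact .map hφ measurable_fst measurable_snd
          (.compProd (s := ⟨t, ht⟩) (Nat.lt_succ_iff.1 hlt) measurable_fst measurable_snd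
            measurable_fst Prod.snd hκf hpu (hcf s (by omega)))
    · rcases hst.eq_or_lt with rfl | hlt
      · exact .of_map_trunc_eq measurable_snd hs' (hself _ _)
      · exact .map hφ measurable_snd measurable_fst
          (.compProd (s := ⟨t, ht⟩) (Nat.lt_succ_iff.1 hlt) measurable_snd measurable_fst
            measurable_snd Prod.fst hκs hqu (hcs s (by omega)))
    · have hNe : MeasurableSet {z : PathSp m T × PathSp m T | z.1 ≠ z.2} :=
        (measurableSet_eq_fun measurable_fst measurable_snd).compl
      have hEe : MeasurableSet {e : (Fin m → ℝ) × (Fin m → ℝ) | e.1 ≠ e.2} :=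
        (measurableSet_eq_fun measurable_fst measurable_snd).compl
      have hstep := compProd_measure_ne_le hB hκB (π := π) (τ := τ) (by
        rw [hf, hs, hpd, hqd, Measure.map_apply
          ((measurable_trunc t).prodMk (measurable_pi_apply _)) hB, Measure.map_apply
          ((measurable_trunc t).prodMk (measurable_pi_apply _)) hB]
        exact hτ _ (((measurable_trunc t).prodMk (measurable_pi_apply _)) hB)) hEe
      rw [Measure.map_apply hφ hNe]
      have hsub : (fun w => (X' w, Y' w)) ⁻¹' {z | z.1 ≠ z.2} ⊆
          {w | w.1.1 ≠ w.1.2 ∨ w.2.1 ≠ w.2.2} := by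
        intro w hw
        by_contra hcon
        simp only [ne_eq, Set.mem_ofPred_eq, not_or, not_not] at hcon
        exact hw (by simp only [hX', hY', hcon.1, hcon.2])
      calc _ ≤ (2 * π {z | z.1 ≠ z.2} + τ) + τ :=
            add_le_add_left ((measure_mono hsub).trans hstep) τ
        _ = 2 * (π {z | z.1 ≠ z.2} + τ) := by ring
        _ ≤ 2 * (2 ^ t * τ) := by gcongr
        _ = 2 ^ (t + 1) * τ := by ring

/-- The nested distance of two measures on a bounded set is controlled by their distance in
total variation. -/
theorem nestedDist_le_of_forall_le_add {m T : ℕ} (P Q : Measure (PathSp m T))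
    [IsProbabilityMeasure P] [IsProbabilityMeasure Q] {τ : ℝ≥0}
    (hτ : ∀ A, MeasurableSet A → P A ≤ Q A + τ) {r : ℝ} (hr : 0 ≤ r)
    (hPr : ∀ᵐ x ∂P, ‖x‖ ≤ r) (hQr : ∀ᵐ x ∂Q, ‖x‖ ≤ r) :
    nestedDist P Q ≤ T * (2 * r) * (2 ^ T * τ) := by
  obtain ⟨π, hπ, hf, hs, hcf, hcs, hne⟩ := exists_trunc_coupling P Q hτ T le_rfl
  have hid : ∀ R : Measure (PathSp m T), R.map (trunc T) = R := fun R => by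
    rw [show (trunc T : PathSp m T → PathSp m T) = id from funext trunc_self, Measure.map_id]
  simp only [hid] at hf hs hcf hcs
  have hnest := isNestedCoupling_of_isCausal hf hs hcf hcs
  have hnn : ∀ z : PathSp m T × PathSp m T, 0 ≤ pathDist z.1 z.2 := fun z =>
    Finset.sum_nonneg fun _ _ => dist_nonneg
  have hbdd : BddBelow {r | ∃ π, IsNestedCoupling P Q π ∧ r = ∫ z, pathDist z.1 z.2 ∂π} :=
    ⟨0, by rintro _ ⟨π', -, rfl⟩; exact integral_nonneg hnn⟩
  refine (csInf_le hbdd (show ∫ z, pathDist z.1 z.2 ∂π ∈ _ from ⟨π, hnest, rfl⟩)).trans ?_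
  have hN : MeasurableSet {z : PathSp m T × PathSp m T | z.1 ≠ z.2} :=
    (measurableSet_eq_fun measurable_fst measurable_snd).compl
  set N := {z : PathSp m T × PathSp m T | z.1 ≠ z.2} with hNdef
  have h1 : ∀ᵐ z ∂π, ‖z.1‖ ≤ r := ae_of_ae_map measurable_fst.aemeasurable (hf ▸ hPr)
  have h2 : ∀ᵐ z ∂π, ‖z.2‖ ≤ r := ae_of_ae_map measurable_snd.aemeasurable (hs ▸ hQr)
  have hbound : ∀ᵐ z ∂π, pathDist z.1 z.2 ≤ N.indicator (fun _ => T * (2 * r)) z := by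
    filter_upwards [h1, h2] with z hz1 hz2
    by_cases hz : z.1 = z.2
    · have : z ∉ N := fun h => h hz
      rw [Set.indicator_of_notMem this, hz]
      simp [pathDist]
    · rw [Set.indicator_of_mem (show z ∈ N from hz)]
      calc pathDist z.1 z.2 ≤ ∑ _t : Fin T, 2 * r := by
            refine Finset.sum_le_sum fun t _ => (dist_le_pi_dist z.1 z.2 t).trans ?_
            rw [dist_eq_norm]
            linarith [norm_sub_le z.1 z.2]
        _ = T * (2 * r) := by simp
  calc ∫ z, pathDist z.1 z.2 ∂π ≤ ∫ z, N.indicator (fun _ => T * (2 * r)) z ∂π :=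
        integral_mono_of_nonneg (Filter.Eventually.of_forall hnn)
          ((integrable_const _).indicator hN) hbound
    _ = T * (2 * r) * π.real N := by
        rw [integral_indicator_const _ hN, smul_eq_mul, mul_comm]
    _ ≤ T * (2 * r) * (2 ^ T * τ) := by
        gcongr
        have h := ENNReal.toReal_mono (by finiteness) (le_self_add.trans hne)
        simpa [Measure.real] using h

/-- Continuity of translation in `L¹`. -/
theorem exists_forall_integral_norm_sub_translate_le {E : Type*} [NormedAddCommGroup E]
    [NormedSpace ℝ E] [FiniteDimensional ℝ E] [MeasurableSpace E] [BorelSpace E] {μ : Measure E}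
    [μ.IsAddHaarMeasure] {g : E → ℝ} (hg : Integrable g μ) {η : ℝ} (hη : 0 < η) :
    ∃ δ > 0, ∀ u : E, ‖u‖ ≤ δ → ∫ x, ‖g x - g (x - u)‖ ∂μ ≤ η := by
  obtain ⟨φ, hφc, hgφ, hφ, hφi⟩ := hg.exists_hasCompactSupport_integral_sub_le
    (show 0 < η / 3 by positivity)
  set S := Metric.cthickening 1 (tsupport φ)
  have hS : IsCompact S := hφc.isCompact.cthickening
  set c : ℝ := μ.real S + 1
  have hc : 0 < c := by positivity
  obtain ⟨δ, hδ, hδφ⟩ := Metric.uniformContinuous_iff.1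
    (hφc.uniformContinuous_of_continuous hφ) (η / 3 / c) (by positivity)
  refine ⟨min 1 (δ / 2), by positivity, fun u hu => ?_⟩
  have hu1 : ‖u‖ ≤ 1 := hu.trans (min_le_left _ _)
  have huδ : ‖u‖ < δ := (hu.trans (min_le_right _ _)).trans_lt (by linarith)
  have hb : ∀ x, ‖φ x - φ (x - u)‖ ≤ S.indicator (fun _ => η / 3 / c) x := by
    intro x
    by_cases hx : x ∈ S
    · rw [Set.indicator_of_mem hx, ← dist_eq_norm]
      exact (hδφ (by simpa [dist_eq_norm] using huδ)).le
    · rw [Set.indicator_of_notMem hx]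
      have h1 : φ x = 0 := image_eq_zero_of_notMem_tsupport fun h =>
        hx (Metric.self_subset_cthickening _ h)
      have h2 : φ (x - u) = 0 := image_eq_zero_of_notMem_tsupport fun h =>
        hx (Metric.mem_cthickening_of_dist_le x (x - u) 1 _ h (by simpa [dist_eq_norm] using hu1))
      simp [h1, h2]
  have hmid : ∫ x, ‖φ x - φ (x - u)‖ ∂μ ≤ η / 3 := by
    calc _ ≤ ∫ x, S.indicator (fun _ => η / 3 / c) x ∂μ := by
          refine integral_mono (hφi.sub (hφi.comp_sub_right u)).norm ?_ hb
          exact (integrable_indicator_iff hS.measurableSet).2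
            (integrableOn_const hS.measure_lt_top.ne enorm_ne_top)
      _ = μ.real S * (η / 3 / c) := by
          rw [integral_indicator_const _ hS.measurableSet, smul_eq_mul]
      _ ≤ c * (η / 3 / c) := by gcongr; simp [c]
      _ = η / 3 := by field_simp
  have hgφi : Integrable (fun x => ‖g x - φ x‖) μ := (hg.sub hφi).norm
  have hgφu : ∫ x, ‖g (x - u) - φ (x - u)‖ ∂μ = ∫ x, ‖g x - φ x‖ ∂μ :=
    integral_sub_right_eq_self (fun x => ‖g x - φ x‖) u
  have hφφ : Integrable (fun x => ‖φ x - φ (x - u)‖) μ := (hφi.sub (hφi.comp_sub_right u)).norm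
  have hsum : Integrable (fun x => ‖g x - φ x‖ + ‖φ x - φ (x - u)‖) μ := hgφi.add hφφ
  have hgφui : Integrable (fun x => ‖g (x - u) - φ (x - u)‖) μ := hgφi.comp_sub_right u
  calc ∫ x, ‖g x - g (x - u)‖ ∂μ
      ≤ ∫ x, (‖g x - φ x‖ + ‖φ x - φ (x - u)‖ + ‖g (x - u) - φ (x - u)‖) ∂μ := by
        refine integral_mono (hg.sub (hg.comp_sub_right u)).norm
          (hsum.add hgφui) fun x => ?_
        have h := norm_add₃_le (a := g x - φ x) (b := φ x - φ (x - u)) (c := φ (x - u) - g (x - u))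
        rw [norm_sub_rev (φ (x - u)) (g (x - u))] at h
        refine le_trans (le_of_eq ?_) h
        congr 1; ring
    _ = ∫ x, ‖g x - φ x‖ ∂μ + ∫ x, ‖φ x - φ (x - u)‖ ∂μ + ∫ x, ‖g x - φ x‖ ∂μ := by
        rw [integral_add hsum hgφui, integral_add hgφi hφφ, hgφu]
    _ ≤ η := by linarith

/-- A finite measure with a density does not charge a set much more than its translates by small
vectors, uniformly over all measurable sets. -/
theorem exists_forall_withDensity_le_translate_add {E : Type*} [NormedAddCommGroup E]
    [NormedSpace ℝ E] [FiniteDimensional ℝ E] [MeasurableSpace E] [BorelSpace E] {μ : Measure E}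
    [μ.IsAddHaarMeasure] {g : E → ℝ} (hg : Integrable g μ) {η : ℝ≥0} (hη : 0 < η) :
    ∃ δ > 0, ∀ u : E, ‖u‖ ≤ δ → ∀ A, MeasurableSet A →
      μ.withDensity (fun x => ENNReal.ofReal (g x)) A ≤
        μ.withDensity (fun x => ENNReal.ofReal (g x)) {x | x + u ∈ A} + η := by
  obtain ⟨δ, hδ, h⟩ := exists_forall_integral_norm_sub_translate_le hg (NNReal.coe_pos.2 hη)
  refine ⟨δ, hδ, fun u hu A hA => ?_⟩
  have hA' : MeasurableSet {x | x + u ∈ A} := (measurable_add_const u) hA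
  have e : ∫⁻ x in {x | x + u ∈ A}, ENNReal.ofReal (g x) ∂μ =
      ∫⁻ x in A, ENNReal.ofReal (g (x - u)) ∂μ := by
    rw [← lintegral_indicator hA', ← lintegral_indicator hA,
      ← lintegral_add_right_eq_self (A.indicator fun x => ENNReal.ofReal (g (x - u))) u]
    refine lintegral_congr fun x => ?_
    by_cases hx : x + u ∈ A <;> simp [hx]
  rw [withDensity_apply _ hA, withDensity_apply _ hA', e]
  have hi : Integrable (fun x => ‖g x - g (x - u)‖) μ := (hg.sub (hg.comp_sub_right u)).norm
  calc ∫⁻ x in A, ENNReal.ofReal (g x) ∂μ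
      ≤ ∫⁻ x in A, (ENNReal.ofReal (g (x - u)) + ENNReal.ofReal ‖g x - g (x - u)‖) ∂μ := by
        refine lintegral_mono fun x => ?_
        refine le_trans (ENNReal.ofReal_le_ofReal ?_) ENNReal.ofReal_add_le
        have := le_abs_self (g x - g (x - u))
        rw [Real.norm_eq_abs]; linarith
    _ = ∫⁻ x in A, ENNReal.ofReal (g (x - u)) ∂μ + ∫⁻ x in A, ENNReal.ofReal ‖g x - g (x - u)‖ ∂μ :=
        lintegral_add_right' _ hi.aestronglyMeasurable.aemeasurable.ennreal_ofReal.restrict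
    _ ≤ _ := by
        refine add_le_add_right ((setLIntegral_le_lintegral _ _).trans ?_) _
        rw [← ofReal_integral_eq_lintegral_ofReal hi
          (Filter.Eventually.of_forall fun x => norm_nonneg _)]
        exact (ENNReal.ofReal_le_ofReal (h u hu)).trans (by simp)

/-- If translating by a small vector changes `P` little, so does adding independent noise that is
almost surely small. -/
theorem measure_le_lintegral_translate_add {E : Type*} [NormedAddCommGroup E]
    [MeasurableSpace E] [BorelSpace E] [SecondCountableTopology E] {P ν : Measure E}
    [IsProbabilityMeasure P] [IsProbabilityMeasure ν] {η : ℝ≥0∞} {δ : ℝ}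
    (hP : ∀ u : E, ‖u‖ ≤ δ → ∀ A, MeasurableSet A → P A ≤ P {x | x + u ∈ A} + η)
    (hν : ∀ᵐ u ∂ν, ‖u‖ ≤ δ) {A : Set E} (hA : MeasurableSet A) :
    P A ≤ ∫⁻ x, ν {u | x + u ∈ A} ∂P + η := by
  have hm : MeasurableSet {z : E × E | z.1 + z.2 ∈ A} := measurable_add hA
  calc P A = ∫⁻ _, P A ∂ν := by simp
    _ ≤ ∫⁻ u, (P {x | x + u ∈ A} + η) ∂ν := by
        refine lintegral_mono_ae ?_
        filter_upwards [hν] with u hu using hP u hu A hA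
    _ = ∫⁻ u, P {x | x + u ∈ A} ∂ν + η := by
        rw [lintegral_add_right _ measurable_const]; simp
    _ = ∫⁻ x, ν {u | x + u ∈ A} ∂P + η := by
        congr 1
        have h1 := Measure.prod_apply (μ := P) (ν := ν) hm
        have h2 := Measure.prod_apply_symm (μ := P) (ν := ν) hm
        exact h2.symm.trans h1

/-- A simple function moving no point of a compact set by more than `δ`. -/
theorem IsCompact.exists_simpleFunc_dist_le {E : Type*} [PseudoMetricSpace E]
    [MeasurableSpace E] [OpensMeasurableSpace E] [TopologicalSpace.SeparableSpace E] [Nonempty E]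
    {S : Set E} (hS : IsCompact S) {δ : ℝ} (hδ : 0 < δ) :
    ∃ G : SimpleFunc E E, ∀ x ∈ S, dist (G x) x ≤ δ := by
  set e := TopologicalSpace.denseSeq E
  have he : DenseRange e := TopologicalSpace.denseRange_denseSeq E
  obtain ⟨t, ht⟩ := hS.elim_finite_subcover (fun k => Metric.ball (e k) δ)
    (fun _ => Metric.isOpen_ball) fun x _ => by
      obtain ⟨k, hk⟩ := he.exists_dist_lt x hδ
      exact Set.mem_iUnion.2 ⟨k, hk⟩
  refine ⟨SimpleFunc.nearestPt e (t.sup id), fun x hx => ?_⟩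
  obtain ⟨k, hk, hxk⟩ := Set.mem_iUnion₂.1 (ht hx)
  have h := SimpleFunc.edist_nearestPt_le e x (Finset.le_sup (f := id) hk)
  rw [edist_dist, edist_dist, id, ENNReal.ofReal_le_ofReal_iff dist_nonneg] at h
  exact h.trans (by rw [dist_comm]; exact (Metric.mem_ball.1 hxk).le)

theorem Finset.sum_mul_le_sum_mul_add {ι : Type*} (s : Finset ι) {p q Φ : ι → ℝ≥0∞} {τ : ℝ≥0∞}
    (hΦ : ∀ i, Φ i ≤ 1) (hq : ∀ i ∈ s, q i ≠ ∞)
    (h : ∀ J ⊆ s, ∑ i ∈ J, p i ≤ ∑ i ∈ J, q i + τ) :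
    ∑ i ∈ s, Φ i * p i ≤ ∑ i ∈ s, Φ i * q i + τ := by
  classical
  set J := s.filter fun i => q i ≤ p i
  have hJ : ∑ i ∈ J, q i ≠ ∞ :=
    ENNReal.sum_ne_top.2 fun i hi => hq i (Finset.filter_subset _ _ hi)
  have h1 : ∑ i ∈ J, Φ i * p i ≤ ∑ i ∈ J, Φ i * q i + τ := by
    refine (ENNReal.add_le_add_iff_right hJ).1 ?_
    calc ∑ i ∈ J, Φ i * p i + ∑ i ∈ J, q i ≤ ∑ i ∈ J, Φ i * q i + ∑ i ∈ J, p i := by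
          rw [← Finset.sum_add_distrib, ← Finset.sum_add_distrib]
          refine Finset.sum_le_sum fun i hi => ?_
          obtain ⟨d, hd⟩ := exists_add_of_le (Finset.mem_filter.1 hi).2
          rw [hd, mul_add, add_assoc, add_comm (q i)]
          exact add_le_add_right (add_le_add_left (mul_le_of_le_one_left' (hΦ i)) _) _
      _ ≤ ∑ i ∈ J, Φ i * q i + (∑ i ∈ J, q i + τ) :=
          add_le_add_right (h J (Finset.filter_subset _ _)) _
      _ = _ := by ring
  have h2 : ∑ i ∈ s with ¬ q i ≤ p i, Φ i * p i ≤ ∑ i ∈ s with ¬ q i ≤ p i, Φ i * q i :=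
    Finset.sum_le_sum fun i hi => by
      gcongr; exact (not_le.1 (Finset.mem_filter.1 hi).2).le
  rw [← Finset.sum_filter_add_sum_filter_not s (fun i => q i ≤ p i),
    ← Finset.sum_filter_add_sum_filter_not s (fun i => q i ≤ p i) (fun i => Φ i * q i)]
  calc _ ≤ (∑ i ∈ J, Φ i * q i + τ) + ∑ i ∈ s with ¬ q i ≤ p i, Φ i * q i := add_le_add h1 h2
    _ = _ := by ring

/-- Integrals of a function with small oscillation are compared through finitely many events. -/
theorem lintegral_le_lintegral_add_of_simpleFunc {E : Type*} [MeasurableSpace E]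
    {P Q : Measure E} [IsProbabilityMeasure P] [IsProbabilityMeasure Q] {Φ : E → ℝ≥0∞}
    (hΦ : ∀ x, Φ x ≤ 1) {τ : ℝ≥0∞} (G : SimpleFunc E E)
    (hGP : ∀ᵐ x ∂P, Φ x ≤ Φ (G x) + τ) (hGQ : ∀ᵐ x ∂Q, Φ (G x) ≤ Φ x + τ)
    (hJ : ∀ J ⊆ G.range, P (G ⁻¹' J) ≤ Q (G ⁻¹' J) + τ) :
    ∫⁻ x, Φ x ∂P ≤ ∫⁻ x, Φ x ∂Q + 3 * τ := by
  have hsum : ∀ ρ : Measure E, ∫⁻ x, Φ (G x) ∂ρ = ∑ c ∈ G.range, Φ c * ρ (G ⁻¹' {c}) := fun ρ => by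
    rw [← SimpleFunc.map_lintegral Φ G, ← SimpleFunc.lintegral_eq_lintegral]
    rfl
  have hpre : ∀ (ρ : Measure E) (J : Finset E), ∑ c ∈ J, ρ (G ⁻¹' {c}) = ρ (G ⁻¹' J) := by
    intro ρ J
    exact sum_measure_preimage_singleton J fun c _ => G.measurableSet_fiber c
  have h2 : ∫⁻ x, Φ (G x) ∂P ≤ ∫⁻ x, Φ (G x) ∂Q + τ := by
    rw [hsum, hsum]
    refine Finset.sum_mul_le_sum_mul_add _ hΦ (fun c _ => measure_ne_top _ _) fun J hJs => ?_
    rw [hpre, hpre]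
    exact hJ J hJs
  have h1 : ∫⁻ x, Φ x ∂P ≤ ∫⁻ x, Φ (G x) ∂P + τ := by
    refine (lintegral_mono_ae hGP).trans (le_of_eq ?_)
    rw [lintegral_add_right _ measurable_const]; simp
  have h3 : ∫⁻ x, Φ (G x) ∂Q ≤ ∫⁻ x, Φ x ∂Q + τ := by
    refine (lintegral_mono_ae hGQ).trans (le_of_eq ?_)
    rw [lintegral_add_right _ measurable_const]; simp
  calc _ ≤ ∫⁻ x, Φ x ∂Q + τ + τ + τ := h1.trans (add_le_add_left (h2.trans
        (add_le_add_left h3 _)) _)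
    _ = _ := by ring

/-- The empirical measure of a finite sample. -/
def empMeasure {E : Type*} [MeasurableSpace E] {n : ℕ} (ω : Fin n → E) : Measure E :=
  (n : ℝ≥0∞)⁻¹ • ∑ j, Measure.dirac (ω j)

theorem lintegral_empMeasure {E : Type*} [MeasurableSpace E] {n : ℕ} (ω : Fin n → E)
    {φ : E → ℝ≥0∞} (hφ : Measurable φ) :
    ∫⁻ x, φ x ∂(empMeasure ω) = (n : ℝ≥0∞)⁻¹ * ∑ j, φ (ω j) := by
  simp [empMeasure, lintegral_smul_measure, lintegral_finsetSum_measure, lintegral_dirac' _ hφ]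

theorem empMeasure_apply {E : Type*} [MeasurableSpace E] {n : ℕ} (ω : Fin n → E)
    {B : Set E} (hB : MeasurableSet B) :
    empMeasure ω B = (n : ℝ≥0∞)⁻¹ * ∑ j, B.indicator 1 (ω j) := by
  rw [← lintegral_indicator_one hB, lintegral_empMeasure ω (measurable_one.indicator hB)]

theorem isProbabilityMeasure_empMeasure {E : Type*} [MeasurableSpace E] {n : ℕ} (hn : n ≠ 0)
    (ω : Fin n → E) : IsProbabilityMeasure (empMeasure ω) := by
  refine ⟨?_⟩
  rw [empMeasure_apply ω MeasurableSet.univ]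
  simp [ENNReal.inv_mul_cancel, hn]

theorem ae_empMeasure {E : Type*} [MeasurableSpace E] {n : ℕ} {ω : Fin n → E} {S : Set E}
    (hS : MeasurableSet S) (h : ∀ j, ω j ∈ S) : ∀ᵐ x ∂(empMeasure ω), x ∈ S := by
  rw [ae_iff]
  change empMeasure ω Sᶜ = 0
  rw [empMeasure_apply ω hS.compl]
  simp [h]

/-- Hoeffding's inequality for the empirical frequency of an event. -/
theorem measure_pi_empMeasure_add_lt_le {E : Type*} [MeasurableSpace E] (P : Measure E)
    [IsProbabilityMeasure P] {n : ℕ} (hn : n ≠ 0) {B : Set E} (hB : MeasurableSet B) (t : ℝ≥0) :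
    (Measure.pi fun _ : Fin n => P) {ω | empMeasure ω B + t < P B} ≤
      ENNReal.ofReal (Real.exp (-(2 * n * (t : ℝ) ^ 2))) := by
  set Z : E → ℝ := B.indicator fun _ => -1
  have hZ : Measurable Z := measurable_const.indicator hB
  have hZint : ∫ x, Z x ∂P = -P.real B := by
    rw [integral_indicator_const _ hB]; simp
  have hmem : ∀ x, Z x ∈ Set.Icc (-1 : ℝ) 0 := fun x => by
    by_cases hx : x ∈ B <;> simp [Z, hx]
  have hindep : iIndepFun (fun (j : Fin n) (ω : Fin n → E) => Z (ω j) + P.real B)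
      (Measure.pi fun _ : Fin n => P) :=
    iIndepFun_pi (X := fun _ x => Z x + P.real B) fun _ => (hZ.add_const _).aemeasurable
  have hmean : ∀ j : Fin n, ∫ ω, Z (ω j) ∂(Measure.pi fun _ : Fin n => P) = -P.real B := fun j => by
    rw [← hZint]
    exact integral_comp_eval (μ := fun _ : Fin n => P) hZ.aestronglyMeasurable
  have hsub : ∀ j ∈ (Finset.univ : Finset (Fin n)),
      HasSubgaussianMGF (fun ω : Fin n → E => Z (ω j) + P.real B) ((‖(0 : ℝ) - (-1)‖₊ / 2) ^ 2)
        (Measure.pi fun _ : Fin n => P) := fun j _ => by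
    have h := hasSubgaussianMGF_of_mem_Icc (μ := Measure.pi fun _ : Fin n => P)
      (X := fun ω : Fin n → E => Z (ω j)) (a := -1) (b := 0)
      (hZ.comp (measurable_pi_apply j)).aemeasurable
      (Filter.Eventually.of_forall fun ω => hmem (ω j))
    simpa only [hmean, sub_neg_eq_add] using h
  have hn0 : (0 : ℝ) < n := by positivity
  have hH := HasSubgaussianMGF.measure_sum_ge_le_of_iIndepFun hindep hsub (ε := n * t) (by positivity)
  have hexp : -((n : ℝ) * t) ^ 2 / (2 * ((∑ _j : Fin n, (‖(0 : ℝ) - (-1)‖₊ / 2) ^ 2 : ℝ≥0) : ℝ)) =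
      -(2 * n * (t : ℝ) ^ 2) := by
    simp
    field_simp
  rw [hexp] at hH
  refine (measure_mono ?_).trans ((ofReal_measureReal (measure_ne_top _ _)).symm.le.trans
    (ENNReal.ofReal_le_ofReal hH))
  intro ω hω
  have hω' : empMeasure ω B + t < P B := hω
  have hprob := isProbabilityMeasure_empMeasure hn ω
  have h1 := (ENNReal.toReal_lt_toReal (by finiteness) (by finiteness)).2 hω'
  rw [ENNReal.toReal_add (by finiteness) (by finiteness), ENNReal.coe_toReal,
    empMeasure_apply ω hB, ENNReal.toReal_mul, ENNReal.toReal_inv, ENNReal.toReal_natCast,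
    ENNReal.toReal_sum fun j _ => by by_cases hx : ω j ∈ B <;> simp [hx]] at h1
  have hZi : ∀ j, (B.indicator (1 : E → ℝ≥0∞) (ω j)).toReal = - Z (ω j) := fun j => by
    by_cases hx : ω j ∈ B <;> simp [Z, hx]
  simp only [hZi, Finset.sum_neg_distrib] at h1
  change (n : ℝ) * t ≤ ∑ j, (Z (ω j) + P.real B)
  rw [Finset.sum_add_distrib]
  simp only [Finset.sum_const, Finset.card_univ, Fintype.card_fin, nsmul_eq_mul]
  have h2 := mul_lt_mul_of_pos_left h1 hn0
  have h3 : (n : ℝ) * ((n : ℝ)⁻¹ * -∑ j, Z (ω j) + t) = -∑ j, Z (ω j) + n * t := by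
    field_simp
  rw [h3] at h2
  change _ < (n : ℝ) * P.real B at h2
  linarith

/-- The kernel rescaled to bandwidth `h`. -/
def scaledKernel {m T : ℕ} (k : PathSp m T → ℝ) (h : ℝ) (x : PathSp m T) : ℝ :=
  (1 / h ^ (m * T)) * k (h⁻¹ • x)

/-- The probability measure with density the rescaled kernel. -/
def kernelMeasure {m T : ℕ} (k : PathSp m T → ℝ) (h : ℝ) : Measure (PathSp m T) :=
  volume.withDensity fun x => ENNReal.ofReal (scaledKernel k h x)

theorem finrank_pathSp (m T : ℕ) : Module.finrank ℝ (PathSp m T) = m * T := by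
  simp [Module.finrank_pi_fintype, mul_comm]

section kernel

variable {m T : ℕ} {k : PathSp m T → ℝ} {h : ℝ}

theorem scaledKernel_nonneg (hk0 : ∀ x, 0 ≤ k x) (hh : 0 < h) (x : PathSp m T) :
    0 ≤ scaledKernel k h x :=
  mul_nonneg (by positivity) (hk0 _)

theorem integrable_scaledKernel (hk : Integrable k) (hh : 0 < h) :
    Integrable (scaledKernel k h) :=
  (hk.comp_smul (inv_ne_zero hh.ne')).const_mul _

theorem integral_scaledKernel (hk : ∫ x, k x = 1) (hh : 0 < h) :
    ∫ x, scaledKernel k h x = 1 := by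
  simp only [scaledKernel]
  rw [integral_const_mul, Measure.integral_comp_inv_smul, finrank_pathSp, hk]
  rw [abs_of_pos (by positivity), smul_eq_mul, mul_one, one_div_mul_cancel (by positivity)]

theorem isProbabilityMeasure_kernelMeasure (hk0 : ∀ x, 0 ≤ k x) (hk : ∫ x, k x = 1)
    (hki : Integrable k) (hh : 0 < h) : IsProbabilityMeasure (kernelMeasure k h) := by
  refine ⟨?_⟩
  rw [kernelMeasure, withDensity_apply _ MeasurableSet.univ, Measure.restrict_univ,
    ← ofReal_integral_eq_lintegral_ofReal (integrable_scaledKernel hki hh)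
      (Filter.Eventually.of_forall (scaledKernel_nonneg hk0 hh)), integral_scaledKernel hk hh,
    ENNReal.ofReal_one]

theorem ae_kernelMeasure (hk : Measurable k) (hksupp : ∀ x : PathSp m T, 1 < ‖x‖ → k x = 0)
    (hh : 0 < h) : ∀ᵐ u ∂(kernelMeasure k h), ‖u‖ ≤ h := by
  have hm : Measurable fun x => ENNReal.ofReal (scaledKernel k h x) := by
    unfold scaledKernel; fun_prop
  rw [kernelMeasure, ae_withDensity_iff hm]
  refine Filter.Eventually.of_forall fun u hu => ?_
  by_contra hcon
  refine hu ?_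
  rw [scaledKernel, hksupp, mul_zero, ENNReal.ofReal_zero]
  rw [norm_smul, norm_inv, Real.norm_of_nonneg hh.le, ← div_eq_inv_mul, one_lt_div hh]
  exact not_le.1 hcon

theorem smoothedEmp_apply (hk : Measurable k) (hk0 : ∀ x, 0 ≤ k x) (hh : 0 < h) {n : ℕ}
    (hn : n ≠ 0) (ω : Fin n → PathSp m T) {A : Set (PathSp m T)} (hA : MeasurableSet A) :
    smoothedEmp k h ω A = ∫⁻ x, kernelMeasure k h {u | x + u ∈ A} ∂(empMeasure ω) := by
  have hm : Measurable fun x => ENNReal.ofReal (scaledKernel k h x) := by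
    unfold scaledKernel; fun_prop
  have hν : ∀ x, kernelMeasure k h {u | x + u ∈ A} =
      ∫⁻ y in A, ENNReal.ofReal (scaledKernel k h (y - x)) := by
    intro x
    have hA' : MeasurableSet {u | x + u ∈ A} := (measurable_const_add x) hA
    rw [kernelMeasure, withDensity_apply _ hA', ← lintegral_indicator hA',
      ← lintegral_indicator hA, ← lintegral_add_left_eq_self
        (A.indicator fun y => ENNReal.ofReal (scaledKernel k h (y - x))) x]
    refine lintegral_congr fun y => ?_
    by_cases hy : x + y ∈ A <;> simp [hy]
  simp only [hν]
  have hmm : Measurable fun x => ∫⁻ y in A, ENNReal.ofReal (scaledKernel k h (y - x)) :=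
    Measurable.lintegral_prod_right'
      (f := fun z : PathSp m T × PathSp m T => ENNReal.ofReal (scaledKernel k h (z.2 - z.1)))
      (hm.comp (measurable_snd.sub measurable_fst))
  have hms : ∀ j, Measurable fun y => ENNReal.ofReal (scaledKernel k h (y - ω j)) := fun j =>
    hm.comp (measurable_id.sub_const _)
  rw [lintegral_empMeasure ω hmm, smoothedEmp, withDensity_apply _ hA,
    ← lintegral_finsetSum _ fun j _ => hms j,
    ← lintegral_const_mul _ (Finset.measurable_sum _ fun j _ => hms j)]
  refine lintegral_congr fun y => ?_
  rw [ENNReal.ofReal_mul (by positivity), ENNReal.ofReal_inv_of_pos (by positivity),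
    ENNReal.ofReal_natCast]
  congr 1
  exact ENNReal.ofReal_sum_of_nonneg fun j _ => scaledKernel_nonneg hk0 hh _

theorem isProbabilityMeasure_smoothedEmp (hk : Measurable k) (hk0 : ∀ x, 0 ≤ k x)
    (hk1 : ∫ x, k x = 1) (hki : Integrable k) (hh : 0 < h) {n : ℕ} (hn : n ≠ 0)
    (ω : Fin n → PathSp m T) : IsProbabilityMeasure (smoothedEmp k h ω) := by
  have := isProbabilityMeasure_kernelMeasure hk0 hk1 hki hh
  have := isProbabilityMeasure_empMeasure hn ω
  refine ⟨?_⟩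
  rw [smoothedEmp_apply hk hk0 hh hn ω MeasurableSet.univ]
  simp

theorem ae_smoothedEmp_norm_le (hk : Measurable k) (hk0 : ∀ x, 0 ≤ k x)
    (hksupp : ∀ x : PathSp m T, 1 < ‖x‖ → k x = 0) (hh : 0 < h) {n : ℕ} (hn : n ≠ 0)
    {ω : Fin n → PathSp m T} {r : ℝ} (hω : ∀ j, ‖ω j‖ ≤ r) :
    ∀ᵐ x ∂(smoothedEmp k h ω), ‖x‖ ≤ r + h := by
  have hm : MeasurableSet {x : PathSp m T | ¬ ‖x‖ ≤ r + h} :=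
    (measurableSet_le measurable_norm measurable_const).compl
  rw [ae_iff, smoothedEmp_apply hk hk0 hh hn ω hm]
  have hae := ae_empMeasure (S := {x : PathSp m T | ‖x‖ ≤ r})
    (measurableSet_le measurable_norm measurable_const) hω
  rw [← lintegral_zero (μ := empMeasure ω)]
  refine lintegral_congr_ae ?_
  filter_upwards [hae] with x hx
  rw [← ae_iff]
  filter_upwards [ae_kernelMeasure hk hksupp hh] with u hu
  exact (norm_add_le x u).trans (add_le_add hx hu)

end kernel

/-- A deterministic comparison: if `P` is almost invariant under translations by at most `h`, the
kernel measure under translations by at most `δ`, and `G` moves points by at most `δ`, then the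
smoothed empirical measure is close to `P` as soon as the empirical measure is accurate on the
finitely many events generated by `G`. -/
theorem le_smoothedEmp_add {m T : ℕ} {P : Measure (PathSp m T)} [IsProbabilityMeasure P]
    {k : PathSp m T → ℝ} (hk : Measurable k) (hk0 : ∀ x, 0 ≤ k x) (hk1 : ∫ x, k x = 1)
    (hki : Integrable k) (hksupp : ∀ x : PathSp m T, 1 < ‖x‖ → k x = 0) {h : ℝ} (hh : 0 < h)
    {τ : ℝ≥0} (hP : ∀ u : PathSp m T, ‖u‖ ≤ h → ∀ A, MeasurableSet A →
      P A ≤ P {x | x + u ∈ A} + τ) {δ : ℝ}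
    (hν : ∀ u : PathSp m T, ‖u‖ ≤ δ → ∀ A, MeasurableSet A →
      kernelMeasure k h A ≤ kernelMeasure k h {x | x + u ∈ A} + τ)
    {S : Set (PathSp m T)} (hS : MeasurableSet S) (hPS : ∀ᵐ x ∂P, x ∈ S)
    (G : SimpleFunc (PathSp m T) (PathSp m T)) (hG : ∀ x ∈ S, dist (G x) x ≤ δ)
    {n : ℕ} (hn : n ≠ 0) {ω : Fin n → PathSp m T} (hω : ∀ j, ω j ∈ S)
    (hJ : ∀ J ⊆ G.range, P (G ⁻¹' J) ≤ empMeasure ω (G ⁻¹' J) + τ)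
    {A : Set (PathSp m T)} (hA : MeasurableSet A) :
    P A ≤ smoothedEmp k h ω A + (4 * τ : ℝ≥0) := by
  have := isProbabilityMeasure_kernelMeasure hk0 hk1 hki hh
  have := isProbabilityMeasure_empMeasure hn ω
  have hosc : ∀ x x' : PathSp m T, dist x x' ≤ δ →
      kernelMeasure k h {u | x + u ∈ A} ≤ kernelMeasure k h {u | x' + u ∈ A} + τ := by
    intro x x' hxx
    have h := hν (x' - x) (by rwa [← dist_eq_norm, dist_comm]) {u | x + u ∈ A}
      ((measurable_const_add x) hA)
    have e : {u | u + (x' - x) ∈ {u | x + u ∈ A}} = {u | x' + u ∈ A} := by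
      ext u
      simp only [Set.mem_ofPred_eq]
      rw [show x + (u + (x' - x)) = x' + u by abel]
    rwa [e] at h
  rw [smoothedEmp_apply hk hk0 hh hn ω hA]
  calc P A ≤ ∫⁻ x, kernelMeasure k h {u | x + u ∈ A} ∂P + τ :=
        measure_le_lintegral_translate_add hP (ae_kernelMeasure hk hksupp hh) hA
    _ ≤ (∫⁻ x, kernelMeasure k h {u | x + u ∈ A} ∂(empMeasure ω) + 3 * τ) + τ := by
        refine add_le_add_left (lintegral_le_lintegral_add_of_simpleFunc (fun x => prob_le_one) G
          ?_ ?_ hJ) _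
        · filter_upwards [hPS] with x hx
          exact hosc _ _ (by rw [dist_comm]; exact hG x hx)
        · filter_upwards [ae_empMeasure hS hω] with x hx
          exact hosc _ _ (hG x hx)
    _ = _ := by push_cast; ring

theorem nestedDist_smoothedEmp_le {m T : ℕ} {P : Measure (PathSp m T)} [IsProbabilityMeasure P]
    {k : PathSp m T → ℝ} (hk : Measurable k) (hk0 : ∀ x, 0 ≤ k x) (hk1 : ∫ x, k x = 1)
    (hki : Integrable k) (hksupp : ∀ x : PathSp m T, 1 < ‖x‖ → k x = 0) {h : ℝ} (hh : 0 < h)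
    (hh1 : h ≤ 1) {r : ℝ} (hr : 0 ≤ r) (hPr : ∀ᵐ x ∂P, ‖x‖ ≤ r) {n : ℕ} (hn : n ≠ 0)
    {ω : Fin n → PathSp m T} (hω : ∀ j, ‖ω j‖ ≤ r) {τ : ℝ≥0}
    (hτ : ∀ A, MeasurableSet A → P A ≤ smoothedEmp k h ω A + τ) :
    nestedDist P (smoothedEmp k h ω) ≤ T * (2 * (r + 1)) * (2 ^ T * τ) := by
  have := isProbabilityMeasure_smoothedEmp hk hk0 hk1 hki hh hn ω
  refine nestedDist_le_of_forall_le_add P _ hτ (by positivity) ?_ ?_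
  · filter_upwards [hPr] with x hx using by linarith
  · filter_upwards [ae_smoothedEmp_norm_le hk hk0 hksupp hh hn hω] with x hx using by linarith

/-- With overwhelming probability the empirical measure is accurate on all events generated by a
simple function. -/
theorem measure_pi_exists_empMeasure_add_lt_le {E : Type*} [MeasurableSpace E] (P : Measure E)
    [IsProbabilityMeasure P] (G : SimpleFunc E E) (τ : ℝ≥0) {n : ℕ} (hn : n ≠ 0) :
    (Measure.pi fun _ : Fin n => P)
        {ω | ∃ J ⊆ G.range, empMeasure ω (G ⁻¹' J) + τ < P (G ⁻¹' J)} ≤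
      ENNReal.ofReal (G.range.powerset.card * Real.exp (-(2 * n * (τ : ℝ) ^ 2))) := by
  have hsub : {ω : Fin n → E | ∃ J ⊆ G.range, empMeasure ω (G ⁻¹' J) + τ < P (G ⁻¹' J)} ⊆
      ⋃ J ∈ G.range.powerset, {ω | empMeasure ω (G ⁻¹' J) + τ < P (G ⁻¹' J)} := by
    rintro ω ⟨J, hJ, h⟩
    exact Set.mem_iUnion₂.2 ⟨J, Finset.mem_powerset.2 hJ, h⟩
  refine (measure_mono hsub).trans ((measure_biUnion_finset_le _ _).trans ?_)
  refine (Finset.sum_le_sum (s := G.range.powerset) fun J _ =>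
    measure_pi_empMeasure_add_lt_le P hn (B := G ⁻¹' (J : Set E))
      (G.measurableSet_preimage J) τ).trans (le_of_eq ?_)
  rw [Finset.sum_const, nsmul_eq_mul, ENNReal.ofReal_mul (by positivity), ENNReal.ofReal_natCast]

theorem ae_pi_forall_mem {E : Type*} [MeasurableSpace E] {P : Measure E} [IsProbabilityMeasure P]
    {S : Set E} (hS : ∀ᵐ x ∂P, x ∈ S) (n : ℕ) :
    (Measure.pi fun _ : Fin n => P) {ω | ¬ ∀ j, ω j ∈ S} = 0 := by
  rw [← ae_iff]
  exact ae_all_iff.2 fun j => (Measure.quasiMeasurePreserving_eval (fun _ : Fin n => P) j).ae hS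

/-- A finite prefactor is absorbed by halving the exponential rate. -/
theorem exists_forall_mul_exp_lt {W a b : ℝ} (ha : 0 < a) (hb : b ≤ a) :
    ∃ N : ℕ, ∀ n : ℕ, N ≤ n → W * Real.exp (-(2 * a * n)) < Real.exp (-(b * n)) := by
  obtain ⟨N, hN⟩ := exists_nat_gt (W / a)
  refine ⟨N, fun n hn => ?_⟩
  have h1 : W < a * n := by
    rw [div_lt_iff₀ ha] at hN
    have : (N : ℝ) ≤ n := by exact_mod_cast hn
    nlinarith
  have h2 : W < Real.exp (a * n) := h1.trans (by linarith [Real.add_one_le_exp (a * n)])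
  calc W * Real.exp (-(2 * a * n)) < Real.exp (a * n) * Real.exp (-(2 * a * n)) := by gcongr
    _ = Real.exp (-(a * n)) := by rw [← Real.exp_add]; congr 1; ring
    _ ≤ Real.exp (-(b * n)) := by gcongr

/-- Theorem 3.2/3.7 of the paper: large deviations for the nested
distance. Under Assumption A4, the smoothed empirical measure built from `n` i.i.d.
sample paths converges to the true model in nested distance at an exponential rate:
`Pⁿ(nd(P, P̂_n * k_h) > ε) < exp(−K n ε^{2ℓ+4})` for an appropriately chosen bandwidth
and `n` large enough. -/
theorem nested_distance_large_deviation
    {m T : ℕ} (P : Measure (PathSp m T)) [IsProbabilityMeasure P]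
    -- A4.1: compact product support `D = D₁ × … × D_T`
    (D : Fin T → Set (Fin m → ℝ)) (hDcpt : ∀ t, IsCompact (D t))
    -- A4.2/A4.3: Lebesgue density `f`, Lipschitz on `D` and bounded there,
    -- vanishing outside `D`
    (f : PathSp m T → ℝ) (L : ℝ) (hL : 0 < L)
    (hdens : P = volume.withDensity fun x => ENNReal.ofReal (f x))
    (hf0 : ∀ x, 0 ≤ f x)
    (hfsupp : ∀ x : PathSp m T, ¬(∀ t, x t ∈ D t) → f x = 0)
    (hfLip : ∀ x : PathSp m T, (∀ t, x t ∈ D t) → ∀ y : PathSp m T,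
      (∀ t, y t ∈ D t) → |f x - f y| ≤ L * dist x y)
    (clo chi : ℝ) (hclo : 0 < clo)
    (hfbounds : ∀ x : PathSp m T, (∀ t, x t ∈ D t) → clo ≤ f x ∧ f x ≤ chi)
    -- A4.4: the kernel vanishes outside the unit ball and is Lipschitz
    (k : PathSp m T → ℝ)
    (hk0 : ∀ x, 0 ≤ k x) (hkint : ∫ x, k x = 1)
    (hksupp : ∀ x : PathSp m T, 1 < ‖x‖ → k x = 0)
    (hkLip : ∀ x y, |k x - k y| ≤ L * dist x y)
    -- A4.5: the conditional distributions are Lipschitz in Wasserstein distance on `D`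
    (γ : ℕ → ℝ) (hγ : ∀ t < T, 0 < γ t)
    (hcondLip : ∀ (t : ℕ) (ht : t < T), ∀ x y : Fin t → Fin m → ℝ,
      (∀ s : Fin t, x s ∈ D ⟨(s : ℕ), lt_trans s.isLt ht⟩) →
      (∀ s : Fin t, y s ∈ D ⟨(s : ℕ), lt_trans s.isLt ht⟩) →
      wdist (condK P t ht x) (condK P t ht y) ≤ γ t * dist x y) :
    ∃ K : ℝ, 0 < K ∧ ∀ ε : ℝ, 0 < ε → ∃ h : ℝ, 0 < h ∧ ∃ N : ℕ, ∀ n ≥ N,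
      (Measure.pi fun _ : Fin n => P)
          {ωs | ε < nestedDist P (smoothedEmp k h ωs)} <
        ENNReal.ofReal (Real.exp (-(K * n * ε ^ (2 * (m * T) + 4)))) := by
  have hLnn : ((L.toNNReal : ℝ≥0) : ℝ) = L := Real.coe_toNNReal L hL.le
  set S : Set (PathSp m T) := Set.pi Set.univ D
  have hmemS : ∀ x : PathSp m T, x ∈ S ↔ ∀ t, x t ∈ D t := fun x => by simp [S]
  have hScpt : IsCompact S := isCompact_univ_pi hDcpt
  have hSm : MeasurableSet S := hScpt.measurableSet
  have hPS : ∀ᵐ x ∂P, x ∈ S := by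
    rw [ae_iff]
    change P Sᶜ = 0
    rw [hdens, withDensity_apply _ hSm.compl, ← lintegral_zero (μ := volume.restrict Sᶜ)]
    refine setLIntegral_congr_fun hSm.compl fun x hx => ?_
    rw [hfsupp x fun hx' => hx ((hmemS x).2 hx'), ENNReal.ofReal_zero]
  have hfm : Measurable f := by
    classical
    have hfc : ContinuousOn f S := (LipschitzOnWith.of_dist_le_mul (K := L.toNNReal)
      fun x hx y hy => by
        rw [hLnn]; exact hfLip x ((hmemS x).1 hx) y ((hmemS y).1 hy)).continuousOn
    have e : f = S.piecewise f fun _ => 0 := by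
      funext x
      by_cases hx : x ∈ S
      · rw [Set.piecewise_eq_of_mem _ _ _ hx]
      · rw [Set.piecewise_eq_of_notMem _ _ _ hx, hfsupp x fun hx' => hx ((hmemS x).2 hx')]
    rw [e]
    exact hfc.measurable_piecewise continuousOn_const hSm
  have hfi : Integrable f := by
    refine (lintegral_ofReal_ne_top_iff_integrable hfm.aestronglyMeasurable
      (Filter.Eventually.of_forall hf0)).1 ?_
    have h : P Set.univ ≠ ∞ := measure_ne_top _ _
    rwa [hdens, withDensity_apply _ MeasurableSet.univ, Measure.restrict_univ] at h
  have hkm : Measurable k := (LipschitzWith.of_dist_le_mul (K := L.toNNReal)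
    fun x y => by rw [hLnn]; exact hkLip x y).continuous.measurable
  have hki : Integrable k := by
    by_contra hcon
    rw [integral_undef hcon] at hkint
    exact zero_ne_one hkint
  obtain ⟨r₀, hr₀⟩ := hScpt.isBounded.exists_norm_le
  set r : ℝ := max r₀ 0
  have hr : 0 ≤ r := le_max_right _ _
  have hrS : ∀ x ∈ S, ‖x‖ ≤ r := fun x hx => (hr₀ x hx).trans (le_max_left _ _)
  have hPr : ∀ᵐ x ∂P, ‖x‖ ≤ r := hPS.mono hrS
  set C : ℝ := T * (2 * (r + 1)) * 2 ^ T
  have hC : 0 ≤ C := by positivity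
  set R : ℝ := C + 1
  have hR : 1 ≤ R := by linarith
  refine ⟨1 / (16 * R ^ 2) / R ^ (2 * (m * T) + 2), by positivity, fun ε hε => ?_⟩
  rcases le_or_gt R ε with hRε | hεR
  · refine ⟨1, one_pos, 1, fun n hn => ?_⟩
    have hn0 : n ≠ 0 := by omega
    refine lt_of_eq_of_lt (measure_mono_null (fun ω hω => ?_) (ae_pi_forall_mem hPS n))
      (ENNReal.ofReal_pos.2 (Real.exp_pos _))
    by_contra hcon
    have hωS : ∀ j, ω j ∈ S := not_not.1 hcon
    have h := nestedDist_smoothedEmp_le hkm hk0 hkint hki hksupp one_pos le_rfl hr hPr hn0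
      (fun j => hrS _ (hωS j)) (τ := 1) fun A _ => prob_le_one.trans (by simp)
    have hω' : ε < nestedDist P (smoothedEmp k 1 ω) := hω
    have e : T * (2 * (r + 1)) * (2 ^ T * ((1 : ℝ≥0) : ℝ)) = C := by simp [C, mul_assoc]
    rw [e] at h
    linarith
  · set τ : ℝ≥0 := ⟨ε / (4 * R), by positivity⟩
    have hτ : (τ : ℝ) = ε / (4 * R) := rfl
    have hτ0 : 0 < τ := by
      rw [← NNReal.coe_pos, hτ]; positivity
    obtain ⟨δ, hδ, hPδ⟩ := exists_forall_withDensity_le_translate_add hfi hτ0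
    rw [← hdens] at hPδ
    set h : ℝ := min 1 δ
    have hh : 0 < h := lt_min one_pos hδ
    obtain ⟨δ', hδ', hνδ⟩ :=
      exists_forall_withDensity_le_translate_add (integrable_scaledKernel hki hh) hτ0
    obtain ⟨G, hG⟩ := hScpt.exists_simpleFunc_dist_le hδ'
    have hrate : 1 / (16 * R ^ 2) / R ^ (2 * (m * T) + 2) * ε ^ (2 * (m * T) + 4) ≤
        ε ^ 2 / (16 * R ^ 2) := by
      suffices ∀ q : ℕ, 1 / (16 * R ^ 2) / R ^ q * ε ^ (q + 2) ≤ ε ^ 2 / (16 * R ^ 2) from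
        this (2 * (m * T) + 2)
      intro q
      have hpow : ε ^ q ≤ R ^ q := by gcongr
      calc _ = ε ^ 2 / (16 * R ^ 2) * (ε ^ q / R ^ q) := by rw [pow_add, mul_comm (ε ^ q)]; field_simp
        _ ≤ ε ^ 2 / (16 * R ^ 2) * 1 := by
            gcongr
            exact div_le_one_of_le₀ hpow (by positivity)
        _ = _ := mul_one _
    obtain ⟨N, hN⟩ := exists_forall_mul_exp_lt (W := G.range.powerset.card)
      (show 0 < ε ^ 2 / (16 * R ^ 2) by positivity) hrate
    refine ⟨h, hh, N + 1, fun n hn => ?_⟩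
    have hn0 : n ≠ 0 := by omega
    have hsub : {ω : Fin n → PathSp m T | ε < nestedDist P (smoothedEmp k h ω)} ⊆
        {ω | ¬ ∀ j, ω j ∈ S} ∪
          {ω | ∃ J ⊆ G.range, empMeasure ω (G ⁻¹' J) + τ < P (G ⁻¹' J)} := by
      intro ω hω
      by_contra hcon
      rw [Set.mem_union, not_or] at hcon
      have hωS : ∀ j, ω j ∈ S := not_not.1 hcon.1
      have hJ : ∀ J ⊆ G.range, P (G ⁻¹' J) ≤ empMeasure ω (G ⁻¹' J) + τ := fun J hJ =>
        not_lt.1 fun hlt => hcon.2 ⟨J, hJ, hlt⟩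
      have hle := nestedDist_smoothedEmp_le hkm hk0 hkint hki hksupp hh (min_le_left _ _) hr hPr
        hn0 (fun j => hrS _ (hωS j)) (τ := 4 * τ) fun A hA =>
          le_smoothedEmp_add hkm hk0 hkint hki hksupp hh
            (fun u hu => hPδ u (hu.trans (min_le_right _ _))) hνδ hSm hPS G hG hn0 hωS hJ hA
      have hω' : ε < nestedDist P (smoothedEmp k h ω) := hω
      have e : T * (2 * (r + 1)) * (2 ^ T * ((4 * τ : ℝ≥0) : ℝ)) = C * (ε / R) := by
        push_cast
        rw [hτ]
        simp only [C]
        field_simp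
      have hCR : C * (ε / R) ≤ ε := by
        rw [← mul_div_assoc, div_le_iff₀ (by positivity)]
        nlinarith
      linarith
    refine (measure_mono hsub).trans_lt ((measure_union_le _ _).trans_lt ?_)
    rw [ae_pi_forall_mem hPS n, zero_add]
    refine (measure_pi_exists_empMeasure_add_lt_le P G τ hn0).trans_lt ?_
    rw [ENNReal.ofReal_lt_ofReal_iff (Real.exp_pos _)]
    have hlt := hN n (by omega)
    have e1 : 2 * (n : ℝ) * (τ : ℝ) ^ 2 = 2 * (ε ^ 2 / (16 * R ^ 2)) * n := by
      rw [hτ]; ring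
    have e2 : 1 / (16 * R ^ 2) / R ^ (2 * (m * T) + 2) * n * ε ^ (2 * (m * T) + 4) =
        1 / (16 * R ^ 2) / R ^ (2 * (m * T) + 2) * ε ^ (2 * (m * T) + 4) * n :=
      mul_right_comm _ _ _
    rw [e1, e2]
    exact hlt

end
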